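/- arXiv:2510.04501 — 2 statements merged into one kernel-verified Lean document; each statement's English description precedes it below -/
import Mathlib

section
/- Assume d > 0 and the strict weak competition condition 0 < b < a < 1/c with c > 0. Then for every wave speed s ≥ s* := max{2, 2√(a·d)}, there exist twice continuously differentiable functions u, v : ℝ → ℝ with u(ξ) > 0 and v(ξ) > 0 for all ξ ∈ ℝ, satisfying u''(ξ) − s·u'(ξ) + u(ξ)·(1 − u(ξ) − c·v(ξ)) = 0 and d·v''(ξ) − s·v'(ξ) + v(ξ)·(a − b·u(ξ) − v(ξ)) = 0 for all ξ ∈ ℝ, together with the boundary conditions lim_{ξ→−∞}(u(ξ), v(ξ)) = (0, 0) and lim_{ξ→+∞}(u(ξ), v(ξ)) = (u*, v*). -/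
open Filter Real
namespace TW
open Set Topology MeasureTheory

lemma drop_right (w w1 : ℝ → ℝ) (w2 y : ℝ) (h1 : ∀ x, HasDerivAt w (w1 x) x)
    (h2 : HasDerivAt w1 w2 y) (hy : w1 y ≤ 0) (hw : w2 < 0) (x : ℝ) (hx : y < x) :
    ∃ z, y < z ∧ z < x ∧ w z < w y := by
  have hs := (hasDerivAt_iff_tendsto_slope.mp h2).eventually (gt_mem_nhds hw)
  have hs' : ∀ᶠ z in 𝓝[>] y, slope w1 y z < 0 :=
    hs.filter_mono (nhdsWithin_mono _ (fun z hz => ne_of_gt hz))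
  obtain ⟨e, he, hsub⟩ := mem_nhdsGT_iff_exists_Ioo_subset.mp hs'
  have he' : y < e := he
  have key : ∀ z, y < z → z < e → w1 z < 0 := by
    intro z hz hze
    have : slope w1 y z < 0 := hsub ⟨hz, hze⟩
    rw [slope_def_field, div_lt_iff₀ (by linarith)] at this
    linarith
  obtain ⟨z, hz1, hz2⟩ := exists_between (lt_min he' hx)
  have hze := lt_of_lt_of_le hz2 (min_le_left _ _)
  have hzx := lt_of_lt_of_le hz2 (min_le_right _ _)
  refine ⟨z, hz1, hzx, ?_⟩
  obtain ⟨t, ht, hte⟩ := exists_hasDerivAt_eq_slope w w1 hz1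
    (fun q _ => (h1 q).continuousAt.continuousWithinAt) (fun q _ => h1 q)
  have := key t ht.1 (ht.2.trans hze)
  rw [hte, div_lt_iff₀ (by linarith)] at this
  linarith

lemma drop_left (w : ℝ → ℝ) (w1 y : ℝ) (h1 : HasDerivAt w w1 y) (hy : 0 < w1) (x : ℝ)
    (hx : x < y) : ∃ z, x < z ∧ z < y ∧ w z < w y := by
  have hs := (hasDerivAt_iff_tendsto_slope.mp h1).eventually (lt_mem_nhds hy)
  have hs' : ∀ᶠ z in 𝓝[<] y, 0 < slope w y z :=
    hs.filter_mono (nhdsWithin_mono _ (fun z hz => ne_of_lt hz))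
  obtain ⟨e, he, hsub⟩ := mem_nhdsLT_iff_exists_Ioo_subset.mp hs'
  have he' : e < y := he
  obtain ⟨z, hz1, hz2⟩ := exists_between (max_lt he' hx)
  have hze := lt_of_le_of_lt (le_max_left _ _) hz1
  have hzx := lt_of_le_of_lt (le_max_right _ _) hz1
  refine ⟨z, hzx, hz2, ?_⟩
  have : 0 < slope w y z := hsub ⟨hze, hz2⟩
  rw [slope_def_field, ← neg_div_neg_eq, lt_div_iff₀ (by linarith)] at this
  linarith

lemma lin_ge (w w1 : ℝ → ℝ) (h1 : ∀ x, HasDerivAt w (w1 x) x) (x0 k : ℝ)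
    (hk : ∀ x, x0 ≤ x → k ≤ w1 x) (x : ℝ) (hx : x0 ≤ x) : w x0 + k * (x - x0) ≤ w x := by
  rcases hx.eq_or_lt with h | h
  · subst h; simp
  obtain ⟨t, ht, hte⟩ := exists_hasDerivAt_eq_slope w w1 h
    (fun q _ => (h1 q).continuousAt.continuousWithinAt) (fun q _ => h1 q)
  have := hk t ht.1.le
  rw [hte, le_div_iff₀ (by linarith)] at this
  linarith

lemma asym_lower (d s X m lo hi : ℝ) (w w1 w2 g p : ℝ → ℝ) (hd : 0 < d) (hs : 0 < s)
    (h1 : ∀ x, HasDerivAt w (w1 x) x) (h2 : ∀ x, HasDerivAt w1 (w2 x) x)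
    (heq : ∀ x, d * w2 x = s * w1 x - g x)
    (hlo : ∀ x, lo ≤ w x) (hhi : ∀ x, w x ≤ hi)
    (hg : ∀ x, X ≤ x → p x * (m - w x) ≤ g x) (hp : ∀ x, 0 < p x)
    (hpp : ∀ x0, ∀ ε > 0, ∃ κ > 0, ∀ x, w x0 ≤ w x → w x ≤ m - ε → κ ≤ p x) :
    ∀ ε > 0, ∀ᶠ x in atTop, m - ε ≤ w x := by
  have cw : Continuous w := continuous_iff_continuousAt.mpr fun x => (h1 x).continuousAt
  have gpos : ∀ x, X ≤ x → w x < m → 0 < g x := fun x hx hm =>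
    lt_of_lt_of_le (mul_pos (hp x) (by linarith)) (hg x hx)
  have step1 : ∀ x, X ≤ x → w x < m → 0 < w1 x := by
    intro x0 hx0 hm
    by_contra hneg
    push Not at hneg
    have minpt : ∀ x, x0 ≤ x → ∀ t, x0 ≤ t → t ≤ x → w x ≤ w t := by
      intro x hx t ht1 ht2
      obtain ⟨y, hy, hmin⟩ := (isCompact_Icc (a := x0) (b := x)).exists_isMinOn
        ⟨x0, left_mem_Icc.mpr hx⟩ cw.continuousOn
      rw [isMinOn_iff] at hmin
      rcases hy.2.eq_or_lt with h | h
      · rw [← h]; exact hmin t ⟨ht1, ht2⟩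
      exfalso
      have hwy : w y ≤ w x0 := hmin x0 (left_mem_Icc.mpr hx)
      have hw1 : w1 y ≤ 0 := by
        rcases hy.1.eq_or_lt with h' | h'
        · rw [← h']; exact hneg
        · have : IsLocalMin w y := by
            filter_upwards [Icc_mem_nhds h' h] with q hq using hmin q hq
          exact (this.hasDerivAt_eq_zero (h1 y)).le
      have hgy := gpos y (hx0.trans hy.1) (by linarith)
      have hw2 : w2 y < 0 := by
        have := heq y
        by_contra hc
        push Not at hc
        nlinarith [mul_nonneg hd.le hc]
      obtain ⟨z, hz1, hz2, hz3⟩ := drop_right w w1 (w2 y) y h1 (h2 y) hw1 hw2 x h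
      have := hmin z ⟨by linarith [hy.1], hz2.le⟩
      linarith
    have w1np : ∀ x, x0 ≤ x → w1 x ≤ 0 := by
      intro x hx
      rcases hx.eq_or_lt with h | h
      · rw [← h]; exact hneg
      by_contra hc
      push Not at hc
      obtain ⟨z, hz1, hz2, hz3⟩ := drop_left w (w1 x) x (h1 x) hc x0 h
      have := minpt x hx z hz1.le hz2.le
      linarith
    have w2n : ∀ x, x0 ≤ x → w2 x < 0 := by
      intro x hx
      have hgy := gpos x (hx0.trans hx) (lt_of_le_of_lt (minpt x hx x0 le_rfl hx) hm)
      have := heq x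
      have h3 := w1np x hx
      by_contra hc
      push Not at hc
      nlinarith [mul_nonneg hd.le hc]
    obtain ⟨z, hz⟩ : ∃ z, x0 < z ∧ w1 z < 0 := by
      refine ⟨x0 + 1, by linarith, ?_⟩
      obtain ⟨t, ht, hte⟩ := exists_hasDerivAt_eq_slope w1 w2 (show x0 < x0 + 1 by linarith)
        (fun q _ => (h2 q).continuousAt.continuousWithinAt) (fun q _ => h2 q)
      have := w2n t ht.1.le
      rw [hte, div_lt_iff₀ (by linarith)] at this
      linarith
    have hle : ∀ x, z ≤ x → w1 x ≤ w1 z := by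
      intro x hx
      rcases hx.eq_or_lt with h | h
      · rw [h]
      obtain ⟨t, ht, hte⟩ := exists_hasDerivAt_eq_slope w1 w2 h
        (fun q _ => (h2 q).continuousAt.continuousWithinAt) (fun q _ => h2 q)
      have := w2n t (hz.1.le.trans ht.1.le)
      rw [hte, div_lt_iff₀ (by linarith)] at this
      linarith
    have hlin := lin_ge (fun x => - w x) (fun x => - w1 x) (fun x => (h1 x).neg) z (- w1 z)
      (fun x hx => by linarith [hle x hx])
    have hpos : 0 < - w1 z := by linarith [hz.2]
    have h4 := hlin (z + (hi - lo + 1) / (- w1 z))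
      (by have : 0 < (hi - lo + 1) / (- w1 z) := div_pos (by linarith [hlo 0, hhi 0]) hpos
          linarith)
    have h5 : - w1 z * (z + (hi - lo + 1) / (- w1 z) - z) = hi - lo + 1 := by
      have hne : w1 z ≠ 0 := hz.2.ne
      field_simp
      ring
    rw [h5] at h4
    have := hlo (z + (hi - lo + 1) / (- w1 z))
    have := hhi z
    linarith
  intro ε hε
  by_cases hA : ∃ x1, X ≤ x1 ∧ m ≤ w x1
  · obtain ⟨x1, hx1, hm⟩ := hA
    filter_upwards [eventually_ge_atTop x1] with x hx
    by_contra hc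
    push Not at hc
    obtain ⟨y, hy, hmin⟩ := (isCompact_Icc (a := x1) (b := x)).exists_isMinOn
        ⟨x1, left_mem_Icc.mpr hx⟩ cw.continuousOn
    rw [isMinOn_iff] at hmin
    have hwy : w y ≤ w x := hmin x (right_mem_Icc.mpr hx)
    have hyx : x1 < y := by
      rcases hy.1.eq_or_lt with h | h
      · rw [← h] at hwy; linarith
      · exact h
    have := step1 y (hx1.trans hy.1) (by linarith)
    obtain ⟨z, hz1, hz2, hz3⟩ := drop_left w (w1 y) y (h1 y) this x1 hyx
    have := hmin z ⟨hz1.le, by linarith [hy.2]⟩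
    linarith
  · push Not at hA
    have w1p : ∀ x, X ≤ x → 0 < w1 x := fun x hx => step1 x hx (hA x hx)
    have wmono : ∀ x y, X ≤ x → x ≤ y → w x ≤ w y := by
      intro x y hx hxy
      have := lin_ge w w1 h1 x 0 (fun t ht => (w1p t (hx.trans ht)).le) y hxy
      linarith
    by_contra hc
    have hall : ∀ x, X ≤ x → w x ≤ m - ε := by
      intro x hx
      by_contra hc2
      push Not at hc2
      apply hc
      filter_upwards [eventually_ge_atTop x] with y hy
      linarith [wmono x y hx hy]
    obtain ⟨κ, hκ, hk⟩ := hpp X ε hε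
    have gθ : ∀ x, X ≤ x → κ * ε ≤ g x := by
      intro x hx
      refine le_trans ?_ (hg x hx)
      exact mul_le_mul (hk x (wmono X x le_rfl hx) (hall x hx)) (by linarith [hall x hx]) hε.le
        (hp x).le
    set θ := κ * ε with hθ
    have θp : 0 < θ := mul_pos hκ hε
    have w1ge : ∀ x, X ≤ x → θ / s ≤ w1 x := by
      intro x0 hx0
      by_contra hc3
      push Not at hc3
      set η := θ / s - w1 x0 with hη
      have ηp : 0 < η := by linarith
      have hder : ∀ x, HasDerivAt (fun x => - (exp (-(s / d) * x) * (w1 x - θ / s)))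
          (- (exp (-(s / d) * x) * (-(s/d) * 1) * (w1 x - θ / s) + exp (-(s / d) * x) * (w2 x))) x := by
        intro x
        exact ((((hasDerivAt_id x).const_mul (-(s/d))).exp).mul ((h2 x).sub_const _)).neg
      have hmono := lin_ge _ _ hder x0 0 (by
        intro x hx
        have hgx := gθ x (hx0.trans hx)
        have he := heq x
        have : w2 x = (s * w1 x - g x) / d := by rw [← he]; field_simp
        rw [this]
        have hEq : - (exp (-(s / d) * x) * (-(s/d) * 1) * (w1 x - θ / s)
          + exp (-(s / d) * x) * ((s * w1 x - g x) / d))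
          = exp (-(s / d) * x) * ((g x - θ) / d) := by
          field_simp
          ring
        rw [hEq]
        exact mul_nonneg (exp_pos _).le (div_nonneg (by linarith) hd.le))
      set x := x0 + (θ / s) / η * (d / s) with hx
      have hxx : x0 ≤ x := by
        have : 0 < (θ / s) / η * (d / s) := by positivity
        linarith
      have h6 := hmono x hxx
      have h7 : exp (-(s / d) * x0) = exp (-(s / d) * x) * exp ((s / d) * (x - x0)) := by
        rw [← exp_add]; congr 1; ring
      have h8 : (s / d) * (x - x0) = (θ / s) / η := by
        rw [hx]; field_simp; ring
      rw [h8] at h7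
      have h9 := add_one_le_exp ((θ / s) / η)
      rw [h7] at h6
      have h10 : exp (-(s / d) * x) * (w1 x - θ / s + exp (θ / s / η) * η) ≤ 0 := by
        have : w1 x0 - θ / s = - η := by rw [hη]; ring
        rw [this] at h6
        linarith
      have h11 : w1 x - θ / s + exp (θ / s / η) * η ≤ 0 := by
        by_contra h
        push Not at h
        have := mul_pos (exp_pos (-(s / d) * x)) h
        linarith
      have h12 : (θ / s / η + 1) * η ≤ exp (θ / s / η) * η := by gcongr
      have h13 : (θ / s / η + 1) * η = θ / s + η := by field_simp
      have := w1p x (hx0.trans hxx)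
      linarith
    have hpos : 0 < θ / s := by positivity
    have h4 := lin_ge w w1 h1 X (θ / s) w1ge (X + (hi - lo + 1) / (θ / s))
      (by have : 0 < (hi - lo + 1) / (θ / s) := div_pos (by linarith [hlo 0, hhi 0]) hpos
          linarith)
    have h5 : θ / s * (X + (hi - lo + 1) / (θ / s) - X) = hi - lo + 1 := by
      field_simp
      ring
    rw [h5] at h4
    have := hhi (X + (hi - lo + 1) / (θ / s))
    have := hlo X
    linarith

/-- minimum principle on a half line, in touching form -/
lemma minprin (d s β K : ℝ) (hd : 0 < d) (hs : 0 < s) (hβ : 0 < β) (D : ℝ → ℝ)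
    (cD : Continuous D) (hK : ∀ x, -K ≤ D x) (h0 : ∀ x, D x < 0 → x ≤ 0)
    (htouch : ∀ x, D x < 0 → ∃ (f f1 : ℝ → ℝ) (f2 : ℝ), (∀ y, HasDerivAt f (f1 y) y) ∧
      HasDerivAt f1 f2 x ∧ f x = D x ∧ (∀ᶠ y in 𝓝 x, D y ≤ f y) ∧
      d * f2 - s * f1 x - β * f x ≤ 0) : ∀ x, 0 ≤ D x := by
  intro xs
  by_contra hxs
  push Not at hxs
  have hKp : 0 < K := by linarith [hK xs]
  set δ := β / (d + s + β) with hδ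
  have δp : 0 < δ := by positivity
  have δ1 : δ ≤ 1 := by rw [hδ, div_le_one (by positivity)]; linarith
  have δ2 : d * δ ^ 2 + s * δ < β := by
    have e : (d + s + β) * δ = β := by rw [hδ]; field_simp
    nlinarith [mul_nonneg (mul_nonneg hd.le δp.le) (sub_nonneg.mpr δ1), mul_pos hβ δp]
  set ε := - D xs / 2 * exp (δ * xs) with hε
  have εp : 0 < ε := mul_pos (by linarith) (exp_pos _)
  set z : ℝ → ℝ := fun x => D x + ε * exp (-δ * x) with hz
  have zs : z xs < 0 := by
    have : ε * exp (-δ * xs) = - D xs / 2 := by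
      rw [hε, mul_assoc, ← exp_add]; ring_nf; simp
    simp only [hz, this]; linarith
  have cz : Continuous z := by fun_prop
  set R := K / ε / δ with hR
  have Rp : 0 < R := by positivity
  have zl : ∀ x, x ≤ -R → 0 < z x := by
    intro x hx
    have h1 := add_one_le_exp (-δ * x)
    have h2 : K / ε ≤ -δ * x := by
      have : δ * R = K / ε := by rw [hR]; field_simp
      nlinarith
    have h3 : ε * (K / ε + 1) ≤ ε * exp (-δ * x) := by gcongr; linarith
    have h4 : ε * (K / ε + 1) = K + ε := by field_simp
    have := hK x
    simp only [hz]; linarith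
  have zr : ∀ x, 0 < x → 0 < z x := by
    intro x hx
    have : 0 ≤ D x := by
      by_contra h
      push Not at h
      linarith [h0 x h]
    simp only [hz]; positivity
  obtain ⟨y, hy, hmin⟩ := (isCompact_Icc (a := -R) (b := 0)).exists_isMinOn
        ⟨0, right_mem_Icc.mpr (by linarith)⟩ cz.continuousOn
  rw [isMinOn_iff] at hmin
  have hxs' : xs ∈ Icc (-R) 0 := by
    constructor
    · by_contra h
      push Not at h
      linarith [zl xs h.le]
    · exact h0 xs hxs
  have zy : z y < 0 := lt_of_le_of_lt (hmin xs hxs') zs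
  have gmin : ∀ x, z y ≤ z x := by
    intro x
    by_cases ha : x ≤ -R
    · linarith [zl x ha]
    by_cases hb : 0 < x
    · linarith [zr x hb]
    push Not at ha hb
    exact hmin x ⟨ha.le, hb⟩
  have Ey : 0 < ε * exp (-δ * y) := by positivity
  have Dy : D y < 0 := by simp only [hz] at zy; linarith
  obtain ⟨f, f1, f2, hf, hf1, hfy, hfe, hL⟩ := htouch y Dy
  set q : ℝ → ℝ := fun x => f x + ε * exp (-δ * x) with hq
  set q1 : ℝ → ℝ := fun x => f1 x + ε * (exp (-δ * x) * (-δ * 1)) with hq1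
  have dq : ∀ x, HasDerivAt q (q1 x) x := fun x =>
    (hf x).add ((((hasDerivAt_id x).const_mul (-δ)).exp).const_mul ε)
  have dq1 : HasDerivAt q1 (f2 + ε * (exp (-δ * y) * (-δ * 1) * (-δ * 1))) y :=
    hf1.add (((((hasDerivAt_id y).const_mul (-δ)).exp).mul_const (-δ * 1)).const_mul ε)
  have qmin : ∀ᶠ x in 𝓝 y, q y ≤ q x := by
    filter_upwards [hfe] with x hx
    have := gmin x
    simp only [hz] at this
    simp only [hq, hfy]
    linarith
  have q10 : q1 y = 0 := IsLocalMin.hasDerivAt_eq_zero qmin (dq y)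
  have q2 : 0 ≤ f2 + ε * (exp (-δ * y) * (-δ * 1) * (-δ * 1)) := by
    by_contra hc
    push Not at hc
    obtain ⟨e, he, hsub⟩ := mem_nhdsGT_iff_exists_Ioo_subset.mp
      (qmin.filter_mono nhdsWithin_le_nhds : ∀ᶠ x in 𝓝[>] y, q y ≤ q x)
    obtain ⟨x, h1, h2, h3⟩ := drop_right q q1 _ y dq dq1 q10.le hc e he
    have : q y ≤ q x := hsub ⟨h1, h2⟩
    linarith
  simp only [hq1] at q10
  simp only [hz] at zy
  rw [hfy] at hL
  set E := ε * exp (-δ * y) with hE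
  have e1 : f1 y = δ * E := by rw [hE]; linarith
  have e2 : - (δ ^ 2 * E) ≤ f2 := by rw [hE]; linarith
  have e3 : d * (- (δ ^ 2 * E)) ≤ d * f2 := by gcongr
  rw [e1] at hL
  nlinarith [mul_lt_mul_of_pos_right δ2 Ey, mul_lt_mul_of_pos_left zy hβ]


noncomputable def RA (m : ℝ) (F : ℝ → ℝ) (x : ℝ) : ℝ :=
  exp (-m * x) * ∫ y in Iic x, exp (m * y) * F y

/-- measurable with values in `[0, C]` -/
def Adm (C : ℝ) (F : ℝ → ℝ) : Prop := Measurable F ∧ ∀ x, 0 ≤ F x ∧ F x ≤ C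

lemma Adm.neg {C : ℝ} {F : ℝ → ℝ} (h : Adm C F) : Adm C (fun x => F (-x)) :=
  ⟨h.1.comp measurable_neg, fun x => h.2 (-x)⟩

lemma RA_int {m C : ℝ} (hm : 0 < m) {F : ℝ → ℝ} (h : Adm C F) (x : ℝ) :
    IntegrableOn (fun y => exp (m * y) * F y) (Iic x) := by
  have h1 : IntegrableOn (fun y => C * exp (m * y)) (Iic x) :=
    (integrableOn_exp_mul_Iic hm x).const_mul C
  refine Integrable.mono' h1 ?_ ?_
  · exact ((by fun_prop : Measurable fun y => exp (m * y)).mul h.1).aestronglyMeasurable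
  · refine Eventually.of_forall fun y => ?_
    rw [norm_eq_abs, abs_of_nonneg (mul_nonneg (exp_pos _).le (h.2 y).1), mul_comm]
    exact mul_le_mul_of_nonneg_right (h.2 y).2 (exp_pos _).le

lemma RA_mono {m C : ℝ} (hm : 0 < m) {F G : ℝ → ℝ} (hF : Adm C F) (hG : Adm C G)
    (h : ∀ x, F x ≤ G x) (x : ℝ) : RA m F x ≤ RA m G x := by
  unfold RA
  refine mul_le_mul_of_nonneg_left ?_ (exp_pos _).le
  refine setIntegral_mono (RA_int hm hF x) (RA_int hm hG x) fun y => ?_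
  exact mul_le_mul_of_nonneg_left (h y) (exp_pos _).le

lemma RA_const {m : ℝ} (hm : 0 < m) (C x : ℝ) : RA m (fun _ => C) x = C / m := by
  unfold RA
  rw [integral_mul_const, integral_exp_mul_Iic hm, neg_mul, exp_neg]
  have := (exp_pos (m * x)).ne'
  field_simp

lemma RA_nonneg {m C : ℝ} {F : ℝ → ℝ} (hF : Adm C F) (x : ℝ) :
    0 ≤ RA m F x :=
  mul_nonneg (exp_pos _).le (integral_nonneg fun y => mul_nonneg (exp_pos _).le (hF.2 y).1)

lemma RA_le {m C : ℝ} (hm : 0 < m) {F : ℝ → ℝ} (hF : Adm C F) (x : ℝ) :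
    RA m F x ≤ C / m := by
  rw [← RA_const hm C x]
  have hC : 0 ≤ C := (hF.2 0).1.trans (hF.2 0).2
  exact RA_mono hm hF ⟨measurable_const, fun _ => ⟨hC, le_rfl⟩⟩ (fun x => (hF.2 x).2) x

lemma RA_eq {m C : ℝ} (hm : 0 < m) {F : ℝ → ℝ} (hF : Adm C F) (x : ℝ) :
    RA m F x = exp (-m * x) * ((∫ y in Iic (0:ℝ), exp (m * y) * F y)
      + ∫ y in (0:ℝ)..x, exp (m * y) * F y) := by
  unfold RA
  rw [← intervalIntegral.integral_Iic_sub_Iic (RA_int hm hF 0) (RA_int hm hF x)]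
  ring

lemma RA_ii {m C : ℝ} (hm : 0 < m) {F : ℝ → ℝ} (hF : Adm C F) (a b : ℝ) :
    IntervalIntegrable (fun y => exp (m * y) * F y) volume a b :=
  ⟨(RA_int hm hF b).mono_set Ioc_subset_Iic_self, (RA_int hm hF a).mono_set Ioc_subset_Iic_self⟩

lemma RA_cont {m C : ℝ} (hm : 0 < m) {F : ℝ → ℝ} (hF : Adm C F) : Continuous (RA m F) := by
  rw [funext (RA_eq hm hF)]
  have := intervalIntegral.continuous_primitive (RA_ii hm hF) 0
  fun_prop

lemma RA_deriv {m C : ℝ} (hm : 0 < m) {F : ℝ → ℝ} (hF : Adm C F) (cF : Continuous F) (x : ℝ) :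
    HasDerivAt (RA m F) (F x - m * RA m F x) x := by
  have h1 : HasDerivAt (fun x => ∫ y in (0:ℝ)..x, exp (m * y) * F y) (exp (m * x) * F x) x :=
    intervalIntegral.integral_hasDerivAt_right (RA_ii hm hF 0 x)
      (by exact (by fun_prop : Continuous fun y => exp (m * y) * F y).stronglyMeasurableAtFilter _ _)
      (by fun_prop)
  have h2 := (((hasDerivAt_id x).const_mul (-m)).exp).mul
    (h1.const_add (∫ y in Iic (0:ℝ), exp (m * y) * F y))
  rw [RA_eq hm hF x]
  have h3 := h2.congr_of_eventuallyEq (f₁ := RA m F)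
    (Eventually.of_forall fun y => by rw [RA_eq hm hF y]; rfl)
  refine h3.congr_deriv ?_
  simp only [id]
  have : exp (-m * x) * (exp (m * x) * F x) = F x := by
    rw [← mul_assoc, ← exp_add]; simp
  rw [this]; ring

lemma RA_lim {m C : ℝ} (hm : 0 < m) {F : ℕ → ℝ → ℝ} {G : ℝ → ℝ} (hF : ∀ n, Adm C (F n))
    (hl : ∀ x, Tendsto (fun n => F n x) atTop (𝓝 (G x))) (x : ℝ) :
    Tendsto (fun n => RA m (F n) x) atTop (𝓝 (RA m G x)) := by
  unfold RA
  refine Tendsto.const_mul _ ?_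
  refine tendsto_integral_of_dominated_convergence (fun y => C * exp (m * y)) ?_ ?_ ?_ ?_
  · intro n
    exact ((by fun_prop : Measurable fun y => exp (m * y)).mul (hF n).1).aestronglyMeasurable
  · exact (integrableOn_exp_mul_Iic hm x).const_mul C
  · intro n
    refine Eventually.of_forall fun y => ?_
    rw [norm_eq_abs, abs_of_nonneg (mul_nonneg (exp_pos _).le ((hF n).2 y).1), mul_comm]
    exact mul_le_mul_of_nonneg_right ((hF n).2 y).2 (exp_pos _).le
  · exact Eventually.of_forall fun y => (hl y).const_mul _

lemma RA_pos {m C : ℝ} (hm : 0 < m) {F : ℝ → ℝ} (hF : Adm C F) (Y : ℝ)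
    (hY : ∀ y, y ≤ Y → 0 < F y) (x : ℝ) : 0 < RA m F x := by
  unfold RA
  refine mul_pos (exp_pos _) ?_
  rw [setIntegral_pos_iff_support_of_nonneg_ae
    (Eventually.of_forall fun y => mul_nonneg (exp_pos _).le (hF.2 y).1) (RA_int hm hF x)]
  have hsub : Ioo (min x Y - 1) (min x Y) ⊆
      (Function.support fun y => exp (m * y) * F y) ∩ Iic x := by
    intro y hy
    refine ⟨?_, hy.2.le.trans (min_le_left _ _)⟩
    exact (mul_pos (exp_pos _) (hY y (hy.2.le.trans (min_le_right _ _)))).ne'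
  refine lt_of_lt_of_le ?_ (measure_mono hsub)
  simp

structure IsRes (d s β : ℝ) (R : (ℝ → ℝ) → ℝ → ℝ) : Prop where
  mono : ∀ C F G, Adm C F → Adm C G → (∀ x, F x ≤ G x) → ∀ x, R F x ≤ R G x
  nonneg : ∀ C F, Adm C F → ∀ x, 0 ≤ R F x
  le : ∀ C F, Adm C F → ∀ x, R F x ≤ C / β
  cont : ∀ C F, Adm C F → Continuous (R F)
  der : ∀ C F, Adm C F → Continuous F → ∃ w1 : ℝ → ℝ, (∀ x, HasDerivAt (R F) (w1 x) x) ∧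
    ∀ x, HasDerivAt w1 ((s * w1 x + β * R F x - F x) / d) x
  lim : ∀ C (F : ℕ → ℝ → ℝ) G, (∀ n, Adm C (F n)) →
    (∀ x, Tendsto (fun n => F n x) atTop (𝓝 (G x))) → ∀ x,
    Tendsto (fun n => R (F n) x) atTop (𝓝 (R G x))
  pos : ∀ C F, Adm C F → ∀ Y, (∀ y, y ≤ Y → 0 < F y) → ∀ x, 0 < R F x

lemma exists_res (d s β : ℝ) (hd : 0 < d) (hβ : 0 < β) : ∃ R, IsRes d s β R := by
  obtain ⟨q, hq⟩ : ∃ q, q = √(s ^ 2 + 4 * d * β) := ⟨_, rfl⟩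
  have hq2 : q ^ 2 = s ^ 2 + 4 * d * β := by rw [hq, sq_sqrt (by positivity)]
  have hq0 : 0 ≤ q := by rw [hq]; positivity
  have hdβ := mul_pos hd hβ
  have hqs := abs_lt_of_sq_lt_sq (by linarith : s ^ 2 < q ^ 2) hq0
  obtain ⟨hqs1, hqs2⟩ := abs_lt.mp hqs
  obtain ⟨m, hm⟩ : ∃ m, m = (q - s) / (2 * d) := ⟨_, rfl⟩
  obtain ⟨n, hn⟩ : ∃ n, n = (q + s) / (2 * d) := ⟨_, rfl⟩
  have mp : 0 < m := by rw [hm]; exact div_pos (by linarith) (by linarith)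
  have np : 0 < n := by rw [hn]; exact div_pos (by linarith) (by linarith)
  have em : d * m ^ 2 + s * m = β := by rw [hm]; field_simp; linarith
  have en : d * n ^ 2 - s * n = β := by rw [hn]; field_simp; linarith
  have emn : d * (m * n) = β := by rw [hm, hn]; field_simp; linarith
  have kp : 0 < d * (m + n) := by positivity
  refine ⟨fun F x => (RA m F x + RA n (fun y => F (-y)) (-x)) / (d * (m + n)), ?_⟩
  constructor
  · intro C F G hF hG h x
    have h1 := RA_mono mp hF hG h x
    have h2 := RA_mono np hF.neg hG.neg (fun y => h (-y)) (-x)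
    gcongr
  · intro C F hF x
    have h1 := RA_nonneg (m := m) hF x
    have h2 := RA_nonneg (m := n) hF.neg (-x)
    positivity
  · intro C F hF x
    have h1 := RA_le mp hF x
    have h2 := RA_le np hF.neg (-x)
    rw [div_le_iff₀ kp]
    have : C / β * (d * (m + n)) = C / m + C / n := by
      rw [← emn]; field_simp; ring
    linarith
  · intro C F hF
    have h1 := RA_cont mp hF
    have h2 := RA_cont np hF.neg
    fun_prop
  · intro C F hF cF
    have h1 := RA_deriv mp hF cF
    have h2 : ∀ x, HasDerivAt (fun x => RA n (fun y => F (-y)) (-x))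
        (-(F x - n * RA n (fun y => F (-y)) (-x))) x := by
      intro x
      have := (RA_deriv np hF.neg (by fun_prop) (-x)).comp x (hasDerivAt_neg x)
      refine this.congr_deriv ?_
      simp
    refine ⟨fun x => ((F x - m * RA m F x) + (-(F x - n * RA n (fun y => F (-y)) (-x))))
      / (d * (m + n)), fun x => ((h1 x).add (h2 x)).div_const _, fun x => ?_⟩
    have h3 := (((h2 x).const_mul n).sub ((h1 x).const_mul m)).div_const (d * (m + n))
    have h4 : HasDerivAt (fun x => ((F x - m * RA m F x) + (-(F x - n * RA n (fun y => F (-y)) (-x))))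
      / (d * (m + n))) _ x := h3.congr_of_eventuallyEq
        (Eventually.of_forall fun y => by simp only [Pi.sub_apply]; ring)
    refine h4.congr_deriv ?_
    rw [← sub_eq_zero]
    beta_reduce
    have hs : s = d * (n - m) := by
      have : (m + n) * (d * (n - m) - s) = 0 := by linarith
      rcases mul_eq_zero.mp this with h | h
      · linarith
      · linarith
    have hmn : m + n ≠ 0 := by positivity
    rw [← emn, hs]
    field_simp
    ring
  · intro C F G hF hl x
    exact ((RA_lim mp hF hl x).add (RA_lim np (fun k => (hF k).neg) (fun y => hl (-y)) (-x))).div_const _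
  · intro C F hF Y hY x
    have h1 := RA_pos mp hF Y hY x
    have h2 := RA_nonneg (m := n) hF.neg (-x)
    positivity


/-- `f` is a C² type function agreeing with value `y0` at `x`, whose expression `L f` is `l` -/
def Jet (d s r : ℝ) (x y0 l : ℝ) (f : ℝ → ℝ) : Prop :=
  ∃ (f1 : ℝ → ℝ) (f2 : ℝ), (∀ y, HasDerivAt f (f1 y) y) ∧ HasDerivAt f1 f2 x ∧ f x = y0 ∧
    d * f2 - s * f1 x + r * f x = l

structure IsUp (d s r : ℝ) (up : ℝ → ℝ) : Prop where
  cont : Continuous up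
  pos : ∀ x, 0 < up x
  le : ∀ x, up x ≤ r
  touch : ∀ x, up x < r → x ≤ 0 ∧ ∃ f l, Jet d s r x (up x) l f ∧ (∀ᶠ y in 𝓝 x, up y ≤ f y) ∧ l ≤ 0

structure IsLow (d s r : ℝ) (q up low : ℝ → ℝ) : Prop where
  cont : Continuous low
  nonneg : ∀ x, 0 ≤ low x
  le : ∀ x, low x ≤ up x
  pos : ∃ Y, ∀ y, y ≤ Y → 0 < low y
  touch : ∀ x, 0 < low x → x ≤ 0 ∧ ∃ f l, Jet d s r x (low x) l f ∧ (∀ᶠ y in 𝓝 x, f y ≤ low y) ∧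
    q x * low x ≤ l

lemma jet_mk (d s r l : ℝ) (hl : d * l ^ 2 - s * l + r = 0) (w w1 w2 : ℝ → ℝ)
    (h1 : ∀ x, HasDerivAt w (w1 x) x) (h2 : ∀ x, HasDerivAt w1 (w2 x) x) (x : ℝ) :
    Jet d s r x (w x * exp (l * x)) ((d * w2 x - (s - 2 * d * l) * w1 x) * exp (l * x))
      (fun x => w x * exp (l * x)) := by
  have he : ∀ y, HasDerivAt (fun x => exp (l * x)) (exp (l * y) * l) y := fun y => by
    simpa using ((hasDerivAt_id y).const_mul l).exp
  refine ⟨fun y => w1 y * exp (l * y) + w y * (exp (l * y) * l),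
    (w2 x * exp (l * x) + w1 x * (exp (l * x) * l)) +
      (w1 x * (exp (l * x) * l) + w x * (exp (l * x) * l * l)),
    fun y => (h1 y).mul (he y), ?_, rfl, ?_⟩
  · exact ((h2 x).mul (he x)).add ((h1 x).mul ((he x).mul_const l))
  · have : r = s * l - d * l ^ 2 := by linarith
    rw [this]; ring

lemma barriers_mk (d s r l x0 C κ : ℝ) (hl : d * l ^ 2 - s * l + r = 0) (hr : 0 < r)
    (hx0 : x0 ≤ 0) (W W1 W2 : ℝ → ℝ)
    (h1 : ∀ x, HasDerivAt W (W1 x) x) (h2 : ∀ x, HasDerivAt W1 (W2 x) x)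
    (hC : r ≤ C * exp (κ * x0)) (hC0 : 0 ≤ C) (hκ : 0 ≤ κ)
    (e0 : W x0 * exp (l * x0) = r) (hpos : ∀ x ≤ x0, 0 < W x)
    (hle : ∀ x ≤ x0, W x * exp (l * x) ≤ r) (hexp : ∀ x ≤ x0, W x * exp (l * x) ≤ C * exp (κ * x))
    (hL : ∀ x ≤ x0, d * W2 x - (s - 2 * d * l) * W1 x ≤ 0)
    (hV : ∀ M κ', 0 < M → 0 < κ' → ∃ V V1 V2 : ℝ → ℝ, (∀ x, HasDerivAt V (V1 x) x) ∧
      (∀ x, HasDerivAt V1 (V2 x) x) ∧ V x0 ≤ 0 ∧ (∀ x ≤ x0, V x ≤ W x) ∧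
      (∃ Y, ∀ y ≤ Y, 0 < V y) ∧
      ∀ x ≤ x0, 0 < V x → M * exp (κ' * x) * V x ≤ d * V2 x - (s - 2 * d * l) * V1 x) :
    ∃ up, IsUp d s r up ∧ (∀ x, up x ≤ C * exp (κ * x)) ∧
      ∀ M κ', 0 < M → 0 < κ' → ∃ low, IsLow d s r (fun x => M * exp (κ' * x)) up low := by
  have cW : Continuous W := continuous_iff_continuousAt.mpr fun x => (h1 x).continuousAt
  refine ⟨fun x => W (min x x0) * exp (l * min x x0), ⟨by fun_prop, ?_, ?_, ?_⟩, ?_, ?_⟩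
  · intro x
    exact mul_pos (hpos _ (min_le_right _ _)) (exp_pos _)
  · intro x
    exact hle _ (min_le_right _ _)
  · intro x hx
    have hlt : x < x0 := by
      by_contra h
      push Not at h
      simp only [min_eq_right h, e0] at hx
      exact lt_irrefl _ hx
    refine ⟨hlt.le.trans hx0, fun x => W x * exp (l * x),
      (d * W2 x - (s - 2 * d * l) * W1 x) * exp (l * x), ?_, ?_, ?_⟩
    · simp only [min_eq_left hlt.le]
      exact jet_mk d s r l hl W W1 W2 h1 h2 x
    · filter_upwards [Iio_mem_nhds hlt] with y hy
      simp only [min_eq_left (le_of_lt (mem_Iio.mp hy)), le_refl]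
    · exact mul_nonpos_of_nonpos_of_nonneg (hL x hlt.le) (exp_pos _).le
  · intro x
    rcases le_total x x0 with h | h
    · simp only [min_eq_left h]; exact hexp x h
    · simp only [min_eq_right h, e0]
      refine hC.trans ?_
      gcongr
  · intro M κ' hM hκ'
    obtain ⟨V, V1, V2, k1, k2, k0, kle, ⟨Y, kY⟩, kL⟩ := hV M κ' hM hκ'
    have cV : Continuous V := continuous_iff_continuousAt.mpr fun x => (k1 x).continuousAt
    refine ⟨fun x => max 0 (V (min x x0) * exp (l * min x x0)), ⟨by fun_prop, ?_, ?_, ?_, ?_⟩⟩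
    · intro x; exact le_max_left _ _
    · intro x
      refine max_le (mul_pos (hpos _ (min_le_right _ _)) (exp_pos _)).le ?_
      exact mul_le_mul_of_nonneg_right (kle _ (min_le_right _ _)) (exp_pos _).le
    · refine ⟨Y, fun y hy => lt_max_of_lt_right (mul_pos (kY _ ((min_le_left _ _).trans hy)) (exp_pos _))⟩
    · intro x hx
      have hpos' : 0 < V (min x x0) * exp (l * min x x0) := by
        rcases lt_max_iff.mp hx with h | h
        · exact absurd h (lt_irrefl _)
        · exact h
      have hlt : x < x0 := by
        by_contra h
        push Not at h
        rw [min_eq_right h] at hpos'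
        have := mul_nonpos_of_nonpos_of_nonneg k0 (exp_pos (l * x0)).le
        linarith
      have hxe : max 0 (V (min x x0) * exp (l * min x x0)) = V x * exp (l * x) := by
        rw [max_eq_right hpos'.le, min_eq_left hlt.le]
      rw [min_eq_left hlt.le] at hpos'
      have hVx : 0 < V x := pos_of_mul_pos_left hpos' (exp_pos _).le
      refine ⟨hlt.le.trans hx0, fun x => V x * exp (l * x),
        (d * V2 x - (s - 2 * d * l) * V1 x) * exp (l * x), ?_, ?_, ?_⟩
      · simp only [hxe]
        exact jet_mk d s r l hl V V1 V2 k1 k2 x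
      · filter_upwards [Iio_mem_nhds hlt] with y hy
        simp only [min_eq_left (le_of_lt (mem_Iio.mp hy))]
        exact le_max_right _ _
      · simp only [hxe]
        rw [← mul_assoc]
        exact mul_le_mul_of_nonneg_right (kL x hlt.le hVx) (exp_pos _).le

set_option maxHeartbeats 1000000 in
lemma exists_barriers (d s r : ℝ) (hd : 0 < d) (hr : 0 < r) (hs : 2 * √(r * d) ≤ s) :
    ∃ up, ∃ C κ : ℝ, 0 < C ∧ 0 < κ ∧ IsUp d s r up ∧ (∀ x, up x ≤ C * exp (κ * x)) ∧
      ∀ M κ', 0 < M → 0 < κ' → ∃ low, IsLow d s r (fun x => M * exp (κ' * x)) up low := by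
  have hsq : √(r * d) ^ 2 = r * d := sq_sqrt (by positivity)
  have hsp : 0 < √(r * d) := sqrt_pos.mpr (by positivity)
  have sp : 0 < s := by linarith
  have hdisc : 0 ≤ s ^ 2 - 4 * d * r := by nlinarith
  obtain ⟨q, hq⟩ : ∃ q, q = √(s ^ 2 - 4 * d * r) := ⟨_, rfl⟩
  have q0 : 0 ≤ q := by rw [hq]; positivity
  have q2 : q ^ 2 = s ^ 2 - 4 * d * r := by rw [hq, sq_sqrt hdisc]
  have hdr := mul_pos hd hr
  have qs : q < s := by
    by_contra h
    push Not at h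
    nlinarith
  obtain ⟨l, hl⟩ : ∃ l, l = (s - q) / (2 * d) := ⟨_, rfl⟩
  have lp : 0 < l := by rw [hl]; exact div_pos (by linarith) (by linarith)
  have hl0 : d * l ^ 2 - s * l + r = 0 := by rw [hl]; field_simp; linarith
  have hσ : s - 2 * d * l = q := by rw [hl]; field_simp; ring
  have hexpd : ∀ (k y : ℝ), HasDerivAt (fun x => exp (k * x)) (exp (k * y) * k) y := fun k y => by
    simpa using ((hasDerivAt_id y).const_mul k).exp
  rcases q0.eq_or_lt with hq0 | hqp
  · -- critical case
    obtain ⟨A, hA⟩ : ∃ A, A = r * l * exp 1 := ⟨_, rfl⟩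
    have Ap : 0 < A := by rw [hA]; positivity
    have hneg : ∀ x, x ≤ -1 / l → 0 < - x := by
      intro x hx
      have : 0 < 1 / l := by positivity
      rw [neg_div] at hx
      linarith
    have hb : ∀ x, (A * (-x)) * exp (l * x) ≤ 2 * A / l * exp (l / 2 * x) := by
      intro x
      have h1 := add_one_le_exp (-(l / 2 * x))
      have h2 : exp (l * x) = exp (l / 2 * x) * exp (l / 2 * x) := by rw [← exp_add]; ring_nf
      have h3 : exp (l / 2 * x) * exp (-(l / 2 * x)) = 1 := by rw [← exp_add]; simp
      have h4 : -(l / 2 * x) * exp (l / 2 * x) ≤ 1 := by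
        have := exp_pos (l / 2 * x)
        nlinarith
      have h5 : (A * (-x)) * exp (l * x)
          = 2 * A / l * exp (l / 2 * x) * (-(l / 2 * x) * exp (l / 2 * x)) := by
        rw [h2]; field_simp
      rw [h5]
      exact mul_le_of_le_one_right (by positivity) h4
    have hx00 : A * (-(-1 / l)) * exp (l * (-1 / l)) = r := by
      have : l * (-1 / l) = -1 := by field_simp
      rw [this, hA, exp_neg]
      field_simp
    obtain ⟨up, hu1, hu2, hu3⟩ := barriers_mk d s r l (-1 / l) (2 * A / l) (l / 2) hl0 hr
      (by rw [neg_div]; simp [lp.le]) (fun x => A * (-x)) (fun _ => A * (-1)) (fun _ => 0)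
      (fun x => (hasDerivAt_neg x).const_mul A) (fun x => hasDerivAt_const x _)
      (by have := hb (-1 / l); rw [hx00] at this; exact this) (by positivity) (by positivity) hx00
      (fun x hx => mul_pos Ap (hneg x hx)) (by
        intro x hx
        have h1 := add_one_le_exp (-(l * x) - 1)
        have h2 : exp (-(l * x) - 1) * (exp 1 * exp (l * x)) = 1 := by
          rw [← exp_add, ← exp_add]; ring_nf; simp
        have h3 : -(l * x) * (exp 1 * exp (l * x)) ≤ 1 := by
          refine le_trans ?_ h2.le
          exact mul_le_mul_of_nonneg_right (by linarith) (by positivity)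
        rw [hA]
        nlinarith) (fun x _ => hb x) (by rw [hσ, ← hq0]; simp) (by
        intro M κ' hM hκ'
        obtain ⟨ε, hε⟩ : ∃ ε, ε = κ' / 2 := ⟨_, rfl⟩
        have εp : 0 < ε := by rw [hε]; positivity
        have h1e : 0 < 1 - exp (ε * (-1 / l)) := by
          have : exp (ε * (-1 / l)) < 1 := by
            rw [exp_lt_one_iff]
            exact mul_neg_of_pos_of_neg εp (by rw [neg_div]; simp [lp])
          linarith
        obtain ⟨B, hB⟩ : ∃ B, B = M / (d * ε ^ 3) + (1 / l) / (1 - exp (ε * (-1 / l))) := ⟨_, rfl⟩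
        have B1 : M / (d * ε ^ 3) ≤ B := by
          rw [hB]
          have : 0 < (1 / l) / (1 - exp (ε * (-1 / l))) := by positivity
          linarith
        have B2 : (1 / l) / (1 - exp (ε * (-1 / l))) ≤ B := by
          rw [hB]
          have : 0 < M / (d * ε ^ 3) := by positivity
          linarith
        have Bp : 0 < B := lt_of_lt_of_le (by positivity) B1
        rw [div_le_iff₀ (by positivity)] at B1
        rw [div_le_iff₀ h1e] at B2
        have hle : ∀ x ≤ -1 / l, A * (-x - B + B * exp (ε * x)) ≤ A * (-x) := by
          intro x hx
          have : exp (ε * x) ≤ 1 := by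
            rw [exp_le_one_iff]
            nlinarith [hneg x hx]
          refine mul_le_mul_of_nonneg_left ?_ Ap.le
          nlinarith
        refine ⟨fun x => A * (-x - B + B * exp (ε * x)), fun x => A * (-1 + B * (exp (ε * x) * ε)),
          fun x => A * (B * (exp (ε * x) * ε * ε)), ?_, ?_, ?_, hle, ?_, ?_⟩
        · intro x
          exact (((hasDerivAt_neg x).sub_const B).add ((hexpd ε x).const_mul B)).const_mul A
        · intro x
          exact ((((hexpd ε x).mul_const ε).const_mul B).const_add (-1)).const_mul A
        · refine mul_nonpos_of_nonneg_of_nonpos Ap.le ?_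
          have : -(-1 / l) = 1 / l := by ring
          linarith
        · refine ⟨-B, fun y hy => mul_pos Ap ?_⟩
          have : 0 < B * exp (ε * y) := by positivity
          linarith
        · intro x hx hVx
          rw [hσ, ← hq0]
          have h1 : exp (κ' * x) = exp (ε * x) * exp (ε * x) := by
            rw [← exp_add, hε]; ring_nf
          have h2 := add_one_le_exp (-(ε * x))
          have h3 : exp (ε * x) * exp (-(ε * x)) = 1 := by rw [← exp_add]; simp
          have hE := exp_pos (ε * x)
          have h4 : -(ε * x) * exp (ε * x) ≤ 1 := by nlinarith
          have h5 : M * exp (κ' * x) * (A * (-x - B + B * exp (ε * x)))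
              ≤ M * exp (κ' * x) * (A * (-x)) :=
            mul_le_mul_of_nonneg_left (hle x hx) (by positivity)
          refine h5.trans ?_
          have h6 : M * exp (κ' * x) * (A * (-x))
            = (M * A * exp (ε * x) / ε) * (-(ε * x) * exp (ε * x)) := by
            rw [h1]; field_simp
          rw [h6]
          refine (mul_le_of_le_one_right (by positivity) h4).trans ?_
          rw [div_le_iff₀ εp]
          have h7 : (d * (A * (B * (exp (ε * x) * ε * ε))) - 0 * (A * (-1 + B * (exp (ε * x) * ε)))) * ε
            = (B * (d * ε ^ 3)) * (A * exp (ε * x)) := by ring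
          rw [h7, mul_assoc]
          exact mul_le_mul_of_nonneg_right B1 (by positivity))
    exact ⟨up, _, _, by positivity, by positivity, hu1, hu2, hu3⟩
  · obtain ⟨up, hu1, hu2, hu3⟩ := barriers_mk d s r l 0 r l hl0 hr
      le_rfl (fun x => r) (fun _ => 0) (fun _ => 0)
      (fun x => hasDerivAt_const x _) (fun x => hasDerivAt_const x _)
      (by simp) hr.le lp.le (by simp)
      (fun x hx => hr) (by
        intro x hx
        refine mul_le_of_le_one_right hr.le ?_
        rw [exp_le_one_iff]; nlinarith) (fun x _ => le_rfl) (by simp) (by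
        intro M κ' hM hκ'
        obtain ⟨ε, hε⟩ : ∃ ε, ε = min κ' (q / (2 * d)) := ⟨_, rfl⟩
        have εp : 0 < ε := by rw [hε]; exact lt_min hκ' (by positivity)
        have ε1 : ε ≤ κ' := by rw [hε]; exact min_le_left _ _
        have ε2 : ε ≤ q / (2 * d) := by rw [hε]; exact min_le_right _ _
        rw [le_div_iff₀ (by positivity)] at ε2
        obtain ⟨K, hK⟩ : ∃ K, K = 1 + M / (ε * q / 2) := ⟨_, rfl⟩
        have K1 : 1 ≤ K := by
          rw [hK]
          have : 0 < M / (ε * q / 2) := by positivity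
          linarith
        have K2 : M ≤ K * (ε * q / 2) := by
          rw [← div_le_iff₀ (by positivity), hK]; linarith
        refine ⟨fun x => r * (1 - K * exp (ε * x)), fun x => r * (- (K * (exp (ε * x) * ε))),
          fun x => r * (- (K * (exp (ε * x) * ε * ε))), ?_, ?_, ?_, ?_, ?_, ?_⟩
        · intro x
          exact (((hexpd ε x).const_mul K).const_sub 1).const_mul r
        · intro x
          exact ((((hexpd ε x).mul_const ε).const_mul K).neg).const_mul r
        · simp only [mul_zero, exp_zero, mul_one]
          exact mul_nonpos_of_nonneg_of_nonpos hr.le (by linarith)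
        · intro x hx
          have : 0 < K * exp (ε * x) := by positivity
          exact mul_le_of_le_one_right hr.le (by linarith)
        · refine ⟨-K / ε, fun y hy => mul_pos hr ?_⟩
          rw [le_div_iff₀ εp] at hy
          have h1 : exp (ε * y) ≤ exp (-K) := exp_le_exp.mpr (by linarith)
          have h2 := add_one_le_exp K
          have h3 : exp K * exp (-K) = 1 := by rw [← exp_add]; simp
          have h4 := exp_pos (-K)
          nlinarith
        · intro x hx hVx
          rw [hσ]
          have h1 : exp (κ' * x) ≤ exp (ε * x) := exp_le_exp.mpr (by nlinarith)
          have hE := exp_pos (ε * x)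
          have h5 : r * (1 - K * exp (ε * x)) ≤ r :=
            mul_le_of_le_one_right hr.le (by nlinarith)
          have h6 : M * exp (κ' * x) * (r * (1 - K * exp (ε * x))) ≤ M * exp (ε * x) * r := by
            gcongr
          refine h6.trans ?_
          have h7 : d * (r * (- (K * (exp (ε * x) * ε * ε)))) - q * (r * (- (K * (exp (ε * x) * ε))))
            = (K * ε * (q - d * ε)) * (exp (ε * x) * r) := by ring
          rw [h7, mul_assoc]
          refine mul_le_mul_of_nonneg_right (K2.trans ?_) (by positivity)
          have : 0 < K * ε := by positivity
          nlinarith)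
    exact ⟨up, _, _, by positivity, by positivity, hu1, hu2, hu3⟩


def Nl (β r k : ℝ) (u v : ℝ → ℝ) : ℝ → ℝ := fun x => u x * (β + r - u x - k * v x)

lemma Nl_adm {β r k Q : ℝ} (hr : 0 < r) (hk : 0 < k) (hβ : β = r + k * Q) {u v : ℝ → ℝ}
    (mu : Measurable u) (mv : Measurable v) (hu0 : ∀ x, 0 ≤ u x) (hu1 : ∀ x, u x ≤ r)
    (hv0 : ∀ x, 0 ≤ v x) (hv1 : ∀ x, v x ≤ Q) : Adm (β * r) (Nl β r k u v) := by
  refine ⟨by unfold Nl; fun_prop, fun x => ?_⟩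
  have a1 := hu0 x
  have a2 := hu1 x
  have a3 := hv0 x
  have a4 := hv1 x
  have a5 : k * v x ≤ k * Q := by gcongr
  have a6 : 0 ≤ k * v x := by positivity
  unfold Nl
  constructor
  · exact mul_nonneg a1 (by linarith)
  · have : u x * (β + r - u x - k * v x) ≤ u x * (β + r - u x) :=
      mul_le_mul_of_nonneg_left (by linarith) a1
    nlinarith [mul_nonneg (sub_nonneg.mpr a2) (by linarith : 0 ≤ β - u x)]

lemma Nl_mono {β r k Q : ℝ} (hk : 0 < k) (hβ : β = r + k * Q) {u v u' v' : ℝ → ℝ}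
    (hu0 : ∀ x, 0 ≤ u x) (hu1 : ∀ x, u' x ≤ r) (hv1 : ∀ x, v x ≤ Q)
    (huu : ∀ x, u x ≤ u' x) (hvv : ∀ x, v' x ≤ v x) (x : ℝ) :
    Nl β r k u v x ≤ Nl β r k u' v' x := by
  have a1 := hu0 x
  have a2 := hu1 x
  have a4 := hv1 x
  have a5 := huu x
  have a6 := hvv x
  have b5 : k * v x ≤ k * Q := by gcongr
  have b6 : k * v' x ≤ k * v x := by gcongr
  unfold Nl
  have c1 : u' x * (β + r - u' x - k * v x) ≤ u' x * (β + r - u' x - k * v' x) :=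
    mul_le_mul_of_nonneg_left (by linarith) (by linarith)
  refine le_trans ?_ c1
  nlinarith [mul_nonneg (sub_nonneg.mpr a5) (by linarith : 0 ≤ β + r - u x - u' x - k * v x)]

lemma up_comp {d s r k Q β : ℝ} (hd : 0 < d) (hs : 0 < s) (hr : 0 < r) (hk : 0 < k) (hQ : 0 < Q)
    (hβ : β = r + k * Q) {R : (ℝ → ℝ) → ℝ → ℝ} (hR : IsRes d s β R) {up z : ℝ → ℝ}
    (hup : IsUp d s r up) (cz : Continuous z) (hz0 : ∀ x, 0 ≤ z x) (hz1 : ∀ x, z x ≤ Q) (x : ℝ) :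
    R (Nl β r k up z) x ≤ up x := by
  have βp : 0 < β := by rw [hβ]; positivity
  have cu := hup.cont
  have hA := Nl_adm hr hk hβ cu.measurable cz.measurable (fun x => (hup.pos x).le) hup.le hz0 hz1
  have cN : Continuous (Nl β r k up z) := by unfold Nl; fun_prop
  obtain ⟨w1, hw1, hw2⟩ := hR.der _ _ hA cN
  have cT := hR.cont _ _ hA
  have hT : ∀ x, R (Nl β r k up z) x ≤ r := fun x => by
    have := hR.le _ _ hA x
    rwa [mul_div_cancel_left₀ _ βp.ne'] at this
  have := minprin d s β r hd hs βp (fun x => up x - R (Nl β r k up z) x) (by fun_prop)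
    (fun x => by have := hT x; have := hup.pos x; linarith)
    (fun x hx => (hup.touch x (by have := hT x; linarith)).1)
    (fun x hx => by
      obtain ⟨-, f, l, ⟨f1, f2, hf, hf1, hfx, hfl⟩, hfe, hl⟩ := hup.touch x (by have := hT x; linarith)
      refine ⟨fun y => f y - R (Nl β r k up z) y, fun y => f1 y - w1 y, _,
        fun y => (hf y).sub (hw1 y), hf1.sub (hw2 x), by simp only [hfx], ?_, ?_⟩
      · filter_upwards [hfe] with y hy
        linarith
      · have e : d * ((s * w1 x + β * R (Nl β r k up z) x - Nl β r k up z x) / d)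
          = s * w1 x + β * R (Nl β r k up z) x - Nl β r k up z x := by field_simp
        rw [mul_sub, e]
        have h1 := hup.pos x
        have h2 : 0 ≤ up x * (up x + k * z x) := by
          have := hz0 x
          positivity
        rw [hfx] at hfl
        beta_reduce
        rw [hfx]
        have hN : Nl β r k up z x = up x * (β + r - up x - k * z x) := rfl
        rw [hN]
        linarith) x
  linarith

lemma low_comp {d s r k Q β : ℝ} (hd : 0 < d) (hs : 0 < s) (hr : 0 < r) (hk : 0 < k) (hQ : 0 < Q)
    (hβ : β = r + k * Q) {R : (ℝ → ℝ) → ℝ → ℝ} (hR : IsRes d s β R) {up low q z : ℝ → ℝ}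
    (hup : IsUp d s r up) (hlow : IsLow d s r q up low)
    (cz : Continuous z) (hz0 : ∀ x, 0 ≤ z x) (hz1 : ∀ x, z x ≤ Q)
    (hq : ∀ x ≤ 0, low x + k * z x ≤ q x) (x : ℝ) :
    low x ≤ R (Nl β r k low z) x := by
  have βp : 0 < β := by rw [hβ]; positivity
  have cu := hlow.cont
  have hlr : ∀ x, low x ≤ r := fun x => (hlow.le x).trans (hup.le x)
  have hA := Nl_adm hr hk hβ cu.measurable cz.measurable hlow.nonneg hlr hz0 hz1
  have cN : Continuous (Nl β r k low z) := by unfold Nl; fun_prop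
  obtain ⟨w1, hw1, hw2⟩ := hR.der _ _ hA cN
  have cT := hR.cont _ _ hA
  have hT := hR.nonneg _ _ hA
  have := minprin d s β r hd hs βp (fun x => R (Nl β r k low z) x - low x) (by fun_prop)
    (fun x => by have := hT x; have := hlr x; linarith)
    (fun x hx => (hlow.touch x (by have := hT x; linarith)).1)
    (fun x hx => by
      obtain ⟨hx0, f, l, ⟨f1, f2, hf, hf1, hfx, hfl⟩, hfe, hl⟩ :=
        hlow.touch x (by have := hT x; linarith)
      refine ⟨fun y => R (Nl β r k low z) y - f y, fun y => w1 y - f1 y, _,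
        fun y => (hw1 y).sub (hf y), (hw2 x).sub hf1, by simp only [hfx], ?_, ?_⟩
      · filter_upwards [hfe] with y hy
        linarith
      · have e : d * ((s * w1 x + β * R (Nl β r k low z) x - Nl β r k low z x) / d)
          = s * w1 x + β * R (Nl β r k low z) x - Nl β r k low z x := by field_simp
        rw [mul_sub, e]
        have h2 : (low x + k * z x) * low x ≤ q x * low x :=
          mul_le_mul_of_nonneg_right (hq x hx0) (hlow.nonneg x)
        rw [hfx] at hfl
        beta_reduce
        rw [hfx]
        have hN : Nl β r k low z x = low x * (β + r - low x - k * z x) := rfl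
        rw [hN]
        linarith) x
  linarith

lemma mono_iter (T1 T2 : (ℝ → ℝ) → (ℝ → ℝ) → ℝ → ℝ) (low1 up1 low2 up2 : ℝ → ℝ)
    (cl1 : Continuous low1) (cu1 : Continuous up1) (cl2 : Continuous low2) (cu2 : Continuous up2)
    (le1 : ∀ x, low1 x ≤ up1 x) (le2 : ∀ x, low2 x ≤ up2 x)
    (hc1 : ∀ u v : ℝ → ℝ, Continuous u → Continuous v → (∀ x, low1 x ≤ u x) → (∀ x, u x ≤ up1 x) →
      (∀ x, low2 x ≤ v x) → (∀ x, v x ≤ up2 x) → Continuous (T1 u v) ∧ Continuous (T2 v u))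
    (hm : ∀ u v u' v' : ℝ → ℝ, Continuous u → Continuous v → Continuous u' → Continuous v' →
      (∀ x, low1 x ≤ u x) → (∀ x, u' x ≤ up1 x) → (∀ x, low2 x ≤ v' x) → (∀ x, v x ≤ up2 x) →
      (∀ x, u x ≤ u' x) → (∀ x, v' x ≤ v x) → (∀ x, T1 u v x ≤ T1 u' v' x) ∧
        (∀ x, T2 v' u' x ≤ T2 v u x))
    (b1 : ∀ x, low1 x ≤ T1 low1 up2 x) (b2 : ∀ x, T1 up1 low2 x ≤ up1 x)
    (b3 : ∀ x, T2 up2 low1 x ≤ up2 x) (b4 : ∀ x, low2 x ≤ T2 low2 up1 x) :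
    ∃ U V : ℕ → ℝ → ℝ, (∀ n, Continuous (U n)) ∧ (∀ n, Continuous (V n)) ∧
      (∀ n x, low1 x ≤ U n x ∧ U n x ≤ up1 x) ∧ (∀ n x, low2 x ≤ V n x ∧ V n x ≤ up2 x) ∧
      (∀ n, U (n + 1) = T1 (U n) (V n)) ∧ (∀ n, V (n + 1) = T2 (V n) (U n)) ∧
      (∀ x, Monotone fun n => U n x) ∧ (∀ x, Antitone fun n => V n x) := by
  let S : ℕ → (ℝ → ℝ) × (ℝ → ℝ) := fun n =>
    Nat.rec (low1, up2) (fun _ p => (T1 p.1 p.2, T2 p.2 p.1)) n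
  have inv : ∀ n, Continuous (S n).1 ∧ Continuous (S n).2 ∧
      (∀ x, low1 x ≤ (S n).1 x) ∧ (∀ x, (S n).1 x ≤ up1 x) ∧
      (∀ x, low2 x ≤ (S n).2 x) ∧ (∀ x, (S n).2 x ≤ up2 x) ∧
      (∀ x, (S n).1 x ≤ (S (n+1)).1 x) ∧ (∀ x, (S (n+1)).2 x ≤ (S n).2 x) := by
    intro n
    induction n with
    | zero => exact ⟨cl1, cu2, fun x => le_rfl, le1, le2, fun x => le_rfl, b1, b3⟩
    | succ n ih =>
      obtain ⟨i1, i2, i3, i4, i5, i6, i7, i8⟩ := ih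
      have hc := hc1 _ _ i1 i2 i3 i4 i5 i6
      have k1 : ∀ x, low1 x ≤ (S (n+1)).1 x := fun x => (i3 x).trans (i7 x)
      have k4 : ∀ x, (S (n+1)).2 x ≤ up2 x := fun x => (i8 x).trans (i6 x)
      have k2 := hm _ _ _ _ i1 i2 cu1 cl2 i3 (fun x => le_rfl) (fun x => le_rfl) i6 i4 i5
      have k2' : ∀ x, (S (n+1)).1 x ≤ up1 x := fun x => (k2.1 x).trans (b2 x)
      have k3' : ∀ x, low2 x ≤ (S (n+1)).2 x := fun x => (b4 x).trans (k2.2 x)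
      have k5 := hm _ _ _ _ i1 i2 hc.1 hc.2 i3 k2' k3' i6 i7 i8
      exact ⟨hc.1, hc.2, k1, k2', k3', k4, k5.1, k5.2⟩
  refine ⟨fun n => (S n).1, fun n => (S n).2, fun n => (inv n).1, fun n => (inv n).2.1,
    fun n x => ⟨(inv n).2.2.1 x, (inv n).2.2.2.1 x⟩,
    fun n x => ⟨(inv n).2.2.2.2.1 x, (inv n).2.2.2.2.2.1 x⟩, fun n => rfl, fun n => rfl,
    fun x => monotone_nat_of_le_succ fun n => (inv n).2.2.2.2.2.2.1 x,
    fun x => antitone_nat_of_succ_le fun n => (inv n).2.2.2.2.2.2.2 x⟩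

/-- The ODE for one component. -/
def Sol (d s r k : ℝ) (w z : ℝ → ℝ) : Prop :=
  ∃ w1 w2 : ℝ → ℝ, (∀ x, HasDerivAt w (w1 x) x) ∧ (∀ x, HasDerivAt w1 (w2 x) x) ∧
    Continuous w2 ∧ ∀ x, d * w2 x = s * w1 x - w x * (r - w x - k * z x)

lemma sol_of_fix {d s r k Q β : ℝ} (hd : 0 < d) (hr : 0 < r) (hk : 0 < k) 
    (hβ : β = r + k * Q) {R : (ℝ → ℝ) → ℝ → ℝ} (hR : IsRes d s β R) {w z : ℝ → ℝ}
    (cw : Continuous w) (cz : Continuous z) (hw0 : ∀ x, 0 ≤ w x) (hw1 : ∀ x, w x ≤ r)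
    (hz0 : ∀ x, 0 ≤ z x) (hz1 : ∀ x, z x ≤ Q) (hfix : R (Nl β r k w z) = w) :
    Sol d s r k w z := by
  have hA := Nl_adm hr hk hβ cw.measurable cz.measurable hw0 hw1 hz0 hz1
  obtain ⟨w1, h1, h2⟩ := hR.der _ _ hA (by unfold Nl; fun_prop)
  rw [hfix] at h1 h2
  have cw1 : Continuous w1 := continuous_iff_continuousAt.mpr fun x => (h2 x).continuousAt
  refine ⟨w1, _, h1, h2, ?_, ?_⟩
  · unfold Nl; fun_prop
  · intro x
    unfold Nl
    field_simp
    ring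

lemma exists_wave (d1 d2 r1 r2 k1 k2 s : ℝ) (hd1 : 0 < d1) (hd2 : 0 < d2) (hr1 : 0 < r1)
    (hr2 : 0 < r2) (hk1 : 0 < k1) (hk2 : 0 < k2) (hs1 : 2 * √(r1 * d1) ≤ s)
    (hs2 : 2 * √(r2 * d2) ≤ s) :
    ∃ u v : ℝ → ℝ, (∀ x, 0 < u x) ∧ (∀ x, 0 < v x) ∧ (∀ x, u x ≤ r1) ∧ (∀ x, v x ≤ r2) ∧
      Sol d1 s r1 k1 u v ∧ Sol d2 s r2 k2 v u ∧ Tendsto u atBot (𝓝 0) ∧ Tendsto v atBot (𝓝 0) := by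
  have hs : 0 < s := by
    have : 0 < √(r1 * d1) := sqrt_pos.mpr (by positivity)
    linarith
  obtain ⟨up1, C1, κ1, C1p, κ1p, hup1, hC1, hlow1⟩ := exists_barriers d1 s r1 hd1 hr1 hs1
  obtain ⟨up2, C2, κ2, C2p, κ2p, hup2, hC2, hlow2⟩ := exists_barriers d2 s r2 hd2 hr2 hs2
  have κp : 0 < min κ1 κ2 := lt_min κ1p κ2p
  obtain ⟨low1, hl1⟩ := hlow1 (C1 + k1 * C2) (min κ1 κ2) (by positivity) κp
  obtain ⟨low2, hl2⟩ := hlow2 (C2 + k2 * C1) (min κ1 κ2) (by positivity) κp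
  have E1 : ∀ x ≤ 0, up1 x ≤ C1 * exp (min κ1 κ2 * x) := by
    intro x hx
    refine (hC1 x).trans (mul_le_mul_of_nonneg_left (exp_le_exp.mpr ?_) C1p.le)
    nlinarith [min_le_left κ1 κ2]
  have E2 : ∀ x ≤ 0, up2 x ≤ C2 * exp (min κ1 κ2 * x) := by
    intro x hx
    refine (hC2 x).trans (mul_le_mul_of_nonneg_left (exp_le_exp.mpr ?_) C2p.le)
    nlinarith [min_le_right κ1 κ2]
  obtain ⟨β1, hβ1⟩ : ∃ β, β = r1 + k1 * r2 := ⟨_, rfl⟩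
  obtain ⟨β2, hβ2⟩ : ∃ β, β = r2 + k2 * r1 := ⟨_, rfl⟩
  obtain ⟨R1, hR1⟩ := exists_res d1 s β1 hd1 (by rw [hβ1]; positivity)
  obtain ⟨R2, hR2⟩ := exists_res d2 s β2 hd2 (by rw [hβ2]; positivity)
  have A1 : ∀ u v : ℝ → ℝ, Measurable u → Measurable v → (∀ x, low1 x ≤ u x) →
      (∀ x, u x ≤ up1 x) → (∀ x, low2 x ≤ v x) → (∀ x, v x ≤ up2 x) →
      Adm (β1 * r1) (Nl β1 r1 k1 u v) := fun u v mu mv h1 h2 h3 h4 =>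
    Nl_adm hr1 hk1 hβ1 mu mv (fun x => (hl1.nonneg x).trans (h1 x))
      (fun x => (h2 x).trans (hup1.le x)) (fun x => (hl2.nonneg x).trans (h3 x))
      (fun x => (h4 x).trans (hup2.le x))
  have A2 : ∀ u v : ℝ → ℝ, Measurable u → Measurable v → (∀ x, low1 x ≤ u x) →
      (∀ x, u x ≤ up1 x) → (∀ x, low2 x ≤ v x) → (∀ x, v x ≤ up2 x) →
      Adm (β2 * r2) (Nl β2 r2 k2 v u) := fun u v mu mv h1 h2 h3 h4 =>
    Nl_adm hr2 hk2 hβ2 mv mu (fun x => (hl2.nonneg x).trans (h3 x))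
      (fun x => (h4 x).trans (hup2.le x)) (fun x => (hl1.nonneg x).trans (h1 x))
      (fun x => (h2 x).trans (hup1.le x))
  obtain ⟨U, V, cU, cV, bU, bV, eU, eV, mU, mV⟩ := mono_iter
    (fun u v => R1 (Nl β1 r1 k1 u v)) (fun v u => R2 (Nl β2 r2 k2 v u)) low1 up1 low2 up2
    hl1.cont hup1.cont hl2.cont hup2.cont hl1.le hl2.le
    (fun u v cu cv h1 h2 h3 h4 => ⟨hR1.cont _ _ (A1 u v cu.measurable cv.measurable h1 h2 h3 h4),
      hR2.cont _ _ (A2 u v cu.measurable cv.measurable h1 h2 h3 h4)⟩)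
    (by
      intro u v u' v' cu cv cu' cv' h1 h2 h3 h4 h5 h6
      have hA := A1 u v cu.measurable cv.measurable h1 (fun x => (h5 x).trans (h2 x))
        (fun x => (h3 x).trans (h6 x)) h4
      have hA' := A1 u' v' cu'.measurable cv'.measurable (fun x => (h1 x).trans (h5 x)) h2
        h3 (fun x => (h6 x).trans (h4 x))
      have hB := A2 u v cu.measurable cv.measurable h1 (fun x => (h5 x).trans (h2 x))
        (fun x => (h3 x).trans (h6 x)) h4
      have hB' := A2 u' v' cu'.measurable cv'.measurable (fun x => (h1 x).trans (h5 x)) h2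
        h3 (fun x => (h6 x).trans (h4 x))
      refine ⟨hR1.mono _ _ _ hA hA' ?_, hR2.mono _ _ _ hB' hB ?_⟩
      · exact Nl_mono hk1 hβ1 (fun x => (hl1.nonneg x).trans (h1 x))
          (fun x => (h2 x).trans (hup1.le x)) (fun x => (h4 x).trans (hup2.le x)) h5 h6
      · exact Nl_mono hk2 hβ2 (fun x => (hl2.nonneg x).trans (h3 x))
          (fun x => (h4 x).trans (hup2.le x)) (fun x => (h2 x).trans (hup1.le x)) h6 h5)
    (low_comp hd1 hs hr1 hk1 hr2 hβ1 hR1 hup1 hl1 hup2.cont (fun x => (hup2.pos x).le) hup2.le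
      (fun x hx => by
        have h1 := E1 x hx
        have h2 := mul_le_mul_of_nonneg_left (E2 x hx) hk1.le
        have h3 := hl1.le x
        linarith))
    (up_comp hd1 hs hr1 hk1 hr2 hβ1 hR1 hup1 hl2.cont hl2.nonneg
      (fun x => (hl2.le x).trans (hup2.le x)))
    (up_comp hd2 hs hr2 hk2 hr1 hβ2 hR2 hup2 hl1.cont hl1.nonneg
      (fun x => (hl1.le x).trans (hup1.le x)))
    (low_comp hd2 hs hr2 hk2 hr1 hβ2 hR2 hup2 hl2 hup1.cont (fun x => (hup1.pos x).le) hup1.le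
      (fun x hx => by
        have h1 := E2 x hx
        have h2 := mul_le_mul_of_nonneg_left (E1 x hx) hk2.le
        have h3 := hl2.le x
        linarith))
  have limU : ∀ x, Tendsto (fun n => U n x) atTop (𝓝 (⨆ n, U n x)) := fun x =>
    tendsto_atTop_ciSup (mU x) ⟨up1 x, by rintro _ ⟨n, rfl⟩; exact (bU n x).2⟩
  have limV : ∀ x, Tendsto (fun n => V n x) atTop (𝓝 (⨅ n, V n x)) := fun x =>
    tendsto_atTop_ciInf (mV x) ⟨low2 x, by rintro _ ⟨n, rfl⟩; exact (bV n x).1⟩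
  obtain ⟨u, hu⟩ : ∃ u : ℝ → ℝ, u = fun x => ⨆ n, U n x := ⟨_, rfl⟩
  obtain ⟨v, hv⟩ : ∃ v : ℝ → ℝ, v = fun x => ⨅ n, V n x := ⟨_, rfl⟩
  replace limU : ∀ x, Tendsto (fun n => U n x) atTop (𝓝 (u x)) := by rw [hu]; exact limU
  replace limV : ∀ x, Tendsto (fun n => V n x) atTop (𝓝 (v x)) := by rw [hv]; exact limV
  have mu : Measurable u := measurable_of_tendsto_metrizable (fun n => (cU n).measurable)
    (tendsto_pi_nhds.mpr limU)
  have mv : Measurable v := measurable_of_tendsto_metrizable (fun n => (cV n).measurable)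
    (tendsto_pi_nhds.mpr limV)
  have ul : ∀ x, low1 x ≤ u x := fun x => ge_of_tendsto' (limU x) fun n => (bU n x).1
  have uu : ∀ x, u x ≤ up1 x := fun x => le_of_tendsto' (limU x) fun n => (bU n x).2
  have vl : ∀ x, low2 x ≤ v x := fun x => ge_of_tendsto' (limV x) fun n => (bV n x).1
  have vu : ∀ x, v x ≤ up2 x := fun x => le_of_tendsto' (limV x) fun n => (bV n x).2
  have fu : R1 (Nl β1 r1 k1 u v) = u := by
    funext x
    have h1 := hR1.lim (β1 * r1) (fun n => Nl β1 r1 k1 (U n) (V n)) (Nl β1 r1 k1 u v)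
      (fun n => A1 _ _ (cU n).measurable (cV n).measurable (fun x => (bU n x).1)
        (fun x => (bU n x).2) (fun x => (bV n x).1) (fun x => (bV n x).2))
      (fun x => (limU x).mul (((limU x).const_sub (β1 + r1)).sub ((limV x).const_mul k1))) x
    have h2 := (tendsto_add_atTop_iff_nat 1).mpr (limU x)
    simp only [eU] at h2
    exact tendsto_nhds_unique h1 h2
  have fv : R2 (Nl β2 r2 k2 v u) = v := by
    funext x
    have h1 := hR2.lim (β2 * r2) (fun n => Nl β2 r2 k2 (V n) (U n)) (Nl β2 r2 k2 v u)
      (fun n => A2 _ _ (cU n).measurable (cV n).measurable (fun x => (bU n x).1)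
        (fun x => (bU n x).2) (fun x => (bV n x).1) (fun x => (bV n x).2))
      (fun x => (limV x).mul (((limV x).const_sub (β2 + r2)).sub ((limU x).const_mul k2))) x
    have h2 := (tendsto_add_atTop_iff_nat 1).mpr (limV x)
    simp only [eV] at h2
    exact tendsto_nhds_unique h1 h2
  have Au := A1 u v mu mv ul uu vl vu
  have Av := A2 u v mu mv ul uu vl vu
  have cu : Continuous u := by rw [← fu]; exact hR1.cont _ _ Au
  have cv : Continuous v := by rw [← fv]; exact hR2.cont _ _ Av
  have ur : ∀ x, u x ≤ r1 := fun x => (uu x).trans (hup1.le x)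
  have vr : ∀ x, v x ≤ r2 := fun x => (vu x).trans (hup2.le x)
  have u0 : ∀ x, 0 ≤ u x := fun x => (hl1.nonneg x).trans (ul x)
  have v0 : ∀ x, 0 ≤ v x := fun x => (hl2.nonneg x).trans (vl x)
  have texp : ∀ C κ : ℝ, 0 < κ → Tendsto (fun x => C * exp (κ * x)) atBot (𝓝 0) := by
    intro C κ hκ
    have := (tendsto_exp_atBot.comp (tendsto_id.const_mul_atBot hκ)).const_mul C
    simpa using this
  refine ⟨u, v, ?_, ?_, ur, vr, sol_of_fix hd1 hr1 hk1 hβ1 hR1 cu cv u0 ur v0 vr fu,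
    sol_of_fix hd2 hr2 hk2 hβ2 hR2 cv cu v0 vr u0 ur fv, ?_, ?_⟩
  · obtain ⟨Y, hY⟩ := hl1.pos
    intro x
    rw [← fu]
    refine hR1.pos _ _ Au Y (fun y hy => ?_) x
    have h1 := lt_of_lt_of_le (hY y hy) (ul y)
    have h2 := mul_le_mul_of_nonneg_left (vr y) hk1.le
    exact mul_pos h1 (by rw [hβ1]; linarith [ur y])
  · obtain ⟨Y, hY⟩ := hl2.pos
    intro x
    rw [← fv]
    refine hR2.pos _ _ Av Y (fun y hy => ?_) x
    have h1 := lt_of_lt_of_le (hY y hy) (vl y)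
    have h2 := mul_le_mul_of_nonneg_left (ur y) hk2.le
    exact mul_pos h1 (by rw [hβ2]; linarith [vr y])
  · exact squeeze_zero u0 (fun x => (uu x).trans (hC1 x)) (texp C1 κ1 κ1p)
  · exact squeeze_zero v0 (fun x => (vu x).trans (hC2 x)) (texp C2 κ2 κ2p)

lemma bounds_exist (f : ℝ → ℝ) (Q : ℝ) (h0 : ∀ x, 0 < f x) (h1 : ∀ x, f x ≤ Q) :
    ∃ lo hi : ℝ, lo ≤ hi ∧ lo ≤ Q ∧ (∀ ε > 0, ∀ᶠ x in atTop, f x ≤ hi + ε) ∧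
      (∀ ε > 0, ∀ᶠ x in atTop, lo - ε ≤ f x) ∧ (∀ t, (∀ᶠ x in atTop, f x ≤ t) → hi ≤ t) ∧
      (∀ t, (∀ᶠ x in atTop, t ≤ f x) → t ≤ lo) := by
  have ba : IsBoundedUnder (· ≤ ·) atTop f := isBoundedUnder_of ⟨Q, h1⟩
  have bb : IsBoundedUnder (· ≥ ·) atTop f := isBoundedUnder_of ⟨0, fun x => (h0 x).le⟩
  refine ⟨liminf f atTop, limsup f atTop, liminf_le_limsup ba bb, ?_, ?_, ?_, ?_, ?_⟩
  · exact (liminf_le_limsup ba bb).trans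
      (limsup_le_of_le bb.isCoboundedUnder_le (Eventually.of_forall h1))
  · intro ε hε
    filter_upwards [eventually_lt_of_limsup_lt (show limsup f atTop < limsup f atTop + ε by linarith) ba]
      with x hx using hx.le
  · intro ε hε
    filter_upwards [eventually_lt_of_lt_liminf (show liminf f atTop - ε < liminf f atTop by linarith) bb]
      with x hx using hx.le
  · intro t ht
    exact limsup_le_of_le bb.isCoboundedUnder_le ht
  · intro t ht
    exact le_liminf_of_le ba.isCoboundedUnder_ge ht

lemma asym_comp (d s r k Q lo hi : ℝ) (hd : 0 < d) (hs : 0 < s) (hk : 0 < k)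
    (hrk : 0 < r - k * Q) (w z : ℝ → ℝ) (hw0 : ∀ x, 0 < w x) (hw1 : ∀ x, w x ≤ r)
    (hz1 : ∀ x, z x ≤ Q) (hsol : Sol d s r k w z) (hloQ : lo ≤ Q)
    (hhi : ∀ ε > 0, ∀ᶠ x in atTop, z x ≤ hi + ε) (hlo : ∀ ε > 0, ∀ᶠ x in atTop, lo - ε ≤ z x) :
    (∀ ε > 0, ∀ᶠ x in atTop, r - k * hi - ε ≤ w x) ∧
    (∀ ε > 0, ∀ᶠ x in atTop, w x ≤ r - k * lo + ε) := by
  obtain ⟨w1, w2, h1, h2, -, heq⟩ := hsol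
  constructor
  · intro ε hε
    obtain ⟨X, hX⟩ := eventually_atTop.mp (hhi (ε / 2 / k) (by positivity))
    have := asym_lower d s X (r - k * min (hi + ε / 2 / k) Q) 0 r w w1 w2
      (fun x => w x * (r - w x - k * z x)) w hd hs h1 h2 heq (fun x => (hw0 x).le) hw1
      (by
        intro x hx
        refine mul_le_mul_of_nonneg_left ?_ (hw0 x).le
        have := mul_le_mul_of_nonneg_left (le_min (hX x hx) (hz1 x)) hk.le
        linarith) hw0 (fun x0 ε _ => ⟨w x0, hw0 x0, fun x h _ => h⟩) (ε / 2) (by positivity)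
    filter_upwards [this] with x hx
    have h3 := mul_le_mul_of_nonneg_left (min_le_left (hi + ε / 2 / k) Q) hk.le
    have h4 : k * (hi + ε / 2 / k) = k * hi + ε / 2 := by field_simp
    linarith
  · intro ε hε
    obtain ⟨X, hX⟩ := eventually_atTop.mp (hlo (ε / 2 / k) (by positivity))
    have h4 : k * (lo - ε / 2 / k) = k * lo - ε / 2 := by field_simp
    have h5 := mul_le_mul_of_nonneg_left hloQ hk.le
    have := asym_lower d s X (-(r - k * (lo - ε / 2 / k))) (-r) 0 (fun x => - w x)
      (fun x => - w1 x) (fun x => - w2 x)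
      (fun x => - (w x * (r - w x - k * z x))) w hd hs (fun x => (h1 x).neg) (fun x => (h2 x).neg)
      (fun x => by linarith [heq x]) (fun x => by linarith [hw1 x]) (fun x => by linarith [hw0 x])
      (by
        intro x hx
        rw [← mul_neg]
        refine mul_le_mul_of_nonneg_left ?_ (hw0 x).le
        have := mul_le_mul_of_nonneg_left (hX x hx) hk.le
        linarith) hw0 (fun x0 η hη => ⟨η, hη, fun x _ h => by linarith⟩) (ε / 2) (by positivity)
    filter_upwards [this] with x hx
    linarith

lemma tendsto_of_bounds (f : ℝ → ℝ) (L : ℝ) (h1 : ∀ ε > 0, ∀ᶠ x in atTop, f x ≤ L + ε)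
    (h2 : ∀ ε > 0, ∀ᶠ x in atTop, L - ε ≤ f x) : Tendsto f atTop (𝓝 L) := by
  rw [Metric.tendsto_nhds]
  intro ε hε
  filter_upwards [h1 (ε / 2) (by positivity), h2 (ε / 2) (by positivity)] with x a b
  rw [dist_eq, abs_lt]
  constructor <;> linarith

lemma sol_contDiff {d s r k : ℝ} {w z : ℝ → ℝ} (h : Sol d s r k w z) :
    ContDiff ℝ 2 w ∧ ∀ x, d * deriv (deriv w) x - s * deriv w x + w x * (r - w x - k * z x) = 0 := by
  obtain ⟨w1, w2, h1, h2, hc, heq⟩ := h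
  have e1 : deriv w = w1 := funext fun x => (h1 x).deriv
  have e2 : deriv w1 = w2 := funext fun x => (h2 x).deriv
  constructor
  · rw [show (2 : WithTop ℕ∞) = 1 + 1 by norm_num, contDiff_succ_iff_deriv]
    refine ⟨fun x => (h1 x).differentiableAt, by simp, ?_⟩
    rw [e1, contDiff_one_iff_deriv, e2]
    exact ⟨fun x => (h2 x).differentiableAt, hc⟩
  · intro x
    rw [e1, e2]
    linarith [heq x]

end TW

/-- Existence of traveling waves for the weak competition Lotka–Volterra system
for all speeds `s ≥ s* = max {2, 2√(a d)}`, connecting `(0,0)` to the coexistence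
equilibrium `(u*, v*) = ((1-ac)/(1-bc), (a-b)/(1-bc))`. -/
theorem existence_of_traveling_wave
    (a b c d : ℝ) (hd : 0 < d) (hb : 0 < b) (hba : b < a) (hc : 0 < c)
    (hac : a < 1 / c) (s : ℝ) (hs : max 2 (2 * Real.sqrt (a * d)) ≤ s) :
    ∃ u v : ℝ → ℝ, ContDiff ℝ 2 u ∧ ContDiff ℝ 2 v ∧
      (∀ ξ : ℝ, 0 < u ξ) ∧ (∀ ξ : ℝ, 0 < v ξ) ∧
      (∀ ξ : ℝ, deriv (deriv u) ξ - s * deriv u ξ + u ξ * (1 - u ξ - c * v ξ) = 0) ∧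
      (∀ ξ : ℝ, d * deriv (deriv v) ξ - s * deriv v ξ + v ξ * (a - b * u ξ - v ξ) = 0) ∧
      Tendsto u atBot (nhds 0) ∧ Tendsto v atBot (nhds 0) ∧
      Tendsto u atTop (nhds ((1 - a * c) / (1 - b * c))) ∧
      Tendsto v atTop (nhds ((a - b) / (1 - b * c))) := by
  have ap : 0 < a := hb.trans hba
  have hac' : a * c < 1 := by rwa [lt_div_iff₀ hc] at hac
  have hbc : b * c < 1 := by nlinarith
  have hs2 : 2 ≤ s := (le_max_left _ _).trans hs
  obtain ⟨u, v, u0, v0, u1, v1, su, sv, tu, tv⟩ := TW.exists_wave 1 d 1 a c b s one_pos hd one_pos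
    ap hc hb (by simpa using hs2) ((le_max_right _ _).trans hs)
  obtain ⟨cu, eu⟩ := TW.sol_contDiff su
  obtain ⟨cv, ev⟩ := TW.sol_contDiff sv
  obtain ⟨lu, hu, lhu, lu1, u2, u3, u4, u5⟩ := TW.bounds_exist u 1 u0 u1
  obtain ⟨lv, hv, lhv, lv1, v2, v3, v4, v5⟩ := TW.bounds_exist v a v0 v1
  obtain ⟨p1, p2⟩ := TW.asym_comp 1 s 1 c a lv hv one_pos (by linarith) hc (by linarith) u v u0 u1 v1
    su lv1 v2 v3
  obtain ⟨p3, p4⟩ := TW.asym_comp d s a b 1 lu hu hd (by linarith) hb (by linarith) v u v0 v1 u1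
    sv lu1 u2 u3
  have q1 : 1 - c * hv ≤ lu := le_of_forall_pos_le_add fun ε hε => by linarith [u5 _ (p1 ε hε)]
  have q2 : hu ≤ 1 - c * lv := le_of_forall_pos_le_add fun ε hε => u4 _ (p2 ε hε)
  have q3 : a - b * hu ≤ lv := le_of_forall_pos_le_add fun ε hε => by linarith [v5 _ (p3 ε hε)]
  have q4 : hv ≤ a - b * lu := le_of_forall_pos_le_add fun ε hε => v4 _ (p4 ε hε)
  have hk : 0 < 1 - b * c := by linarith
  have r1 : hu = lu := by
    refine le_antisymm ?_ lhu
    by_contra h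
    push Not at h
    have h1 : c * (hv - lv) ≤ c * (b * (hu - lu)) := mul_le_mul_of_nonneg_left (by linarith) hc.le
    nlinarith [mul_pos hk (sub_pos.mpr h)]
  subst r1
  have r2 : hv = lv := le_antisymm (by linarith) lhv
  subst r2
  have f1 : hu = 1 - c * hv := le_antisymm q2 q1
  have f2 : hv = a - b * hu := le_antisymm q4 q3
  have g1 : (1 - a * c) / (1 - b * c) = hu := by
    rw [div_eq_iff hk.ne']
    rw [f2] at f1
    linarith
  have g2 : (a - b) / (1 - b * c) = hv := by
    rw [div_eq_iff hk.ne']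
    rw [f1] at f2
    linarith
  rw [g1, g2]
  refine ⟨u, v, cu, cv, u0, v0, fun x => ?_, fun x => ?_, tu, tv,
    TW.tendsto_of_bounds u hu u2 u3, TW.tendsto_of_bounds v hv v2 v3⟩
  · linarith [eu x]
  · linarith [ev x]
end

section
/- For any d > 0, any 0 < b < a, and any wave speed s ≥ s* := max{2, 2√(a·d)}, there exists δ = δ(a, b, s) with 0 < δ < 1/a such that for every c with δ < c < 1/a there exists a positive twice continuously differentiable solution (u, v) of u'' − s·u' + u·(1 − u − c·v) = 0 and d·v'' − s·v' + v·(a − b·u − v) = 0 on ℝ with lim_{ξ→−∞}(u, v) = (0, 0) and lim_{ξ→+∞}(u, v) = (u*, v*), for which the component u is not monotone on ℝ (u is neither nondecreasing on ℝ nor nonincreasing on ℝ). -/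
open Filter Real

/-- `LVSub σ κ V L`: `L` is a local subsolution wherever it is positive. -/
def LVSub (σ κ : ℝ) (V L : ℝ → ℝ) : Prop :=
  ∀ x, 0 < L x → ∃ g g' g'' : ℝ → ℝ, L =ᶠ[nhds x] g ∧ (∀ t, HasDerivAt g (g' t) t) ∧
    (∀ t, HasDerivAt g' (g'' t) t) ∧ 0 ≤ g'' x - σ * g' x + κ * g x * (1 - g x - V x)

lemma lv_scalar_noncrit (σ κ : ℝ) (hσ : 0 < σ) (hκ : 0 < κ) (h : 4 * κ < σ ^ 2) :
    ∃ U U' U'' : ℝ → ℝ, (∀ t, HasDerivAt U (U' t) t) ∧ (∀ t, HasDerivAt U' (U'' t) t) ∧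
      (∀ x, 0 < U x) ∧ (∀ x, U x ≤ 1) ∧
      (∀ x, U'' x - σ * U' x + κ * U x * (1 - U x) ≤ 0) ∧
      (∃ ρ > 0, ∀ x, U x ≤ 2 * exp (ρ * x)) ∧
      (∀ V : ℝ → ℝ, (∃ ρ > 0, ∀ x, V x ≤ 2 * exp (ρ * x)) →
        ∃ L : ℝ → ℝ, Continuous L ∧ (∀ x, 0 ≤ L x) ∧ (∀ x, L x ≤ U x) ∧
          (∃ X, ∀ x ≤ X, 0 < L x) ∧ LVSub σ κ V L) := by
  obtain ⟨l, hl0, hl1, hl2⟩ : ∃ l : ℝ, 0 < l ∧ l ^ 2 - σ * l + κ = 0 ∧ 2 * l < σ := by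
    have hs : 0 < σ ^ 2 - 4 * κ := by linarith
    have h1 := Real.sq_sqrt hs.le
    have h2 := Real.sqrt_pos.2 hs
    have h3 : √(σ ^ 2 - 4 * κ) < σ := by
      rw [Real.sqrt_lt' hσ]; linarith
    exact ⟨(σ - √(σ ^ 2 - 4 * κ)) / 2, by linarith, by nlinarith, by linarith⟩
  have he : ∀ (r t : ℝ), HasDerivAt (fun x => exp (r * x)) (r * exp (r * t)) t := by
    intro r t
    have := ((hasDerivAt_id t).const_mul r).exp
    simpa [mul_comm] using this
  let U : ℝ → ℝ := fun x => 1 - (1 + exp (l * x))⁻¹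
  have hU : ∀ t, HasDerivAt U (l * U t * (1 - U t)) t := by
    intro t
    have hp : 1 + exp (l * t) ≠ 0 := by positivity
    have := (((he l t).const_add 1).fun_inv hp).const_sub 1
    refine this.congr_deriv ?_
    simp only [U]
    field_simp
    ring
  refine ⟨U, fun t => l * U t * (1 - U t),
    fun t => l * (l * U t * (1 - U t)) * (1 - U t) + l * U t * (-(l * U t * (1 - U t))),
    hU, ?_, ?_, ?_, ?_, ?_, ?_⟩
  · intro t
    exact ((hU t).const_mul l).mul ((hU t).const_sub 1)
  · intro x
    have h1 : (1 + exp (l * x))⁻¹ < 1 := inv_lt_one_of_one_lt₀ (by linarith [exp_pos (l * x)])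
    simp only [U]; linarith
  · intro x
    have : 0 < (1 + exp (l * x))⁻¹ := by positivity
    simp only [U]; linarith
  · intro x
    have h0 : 0 < (1 + exp (l * x))⁻¹ := by positivity
    have e : l * (l * U x * (1 - U x)) * (1 - U x) + l * U x * (-(l * U x * (1 - U x))) -
      σ * (l * U x * (1 - U x)) + κ * U x * (1 - U x) = U x * (1 - U x) * (l ^ 2 - σ * l + κ)
        - 2 * l ^ 2 * (U x) ^ 2 * (1 - U x) := by ring
    rw [e, hl1]
    have : 0 ≤ 1 - U x := by simp only [U]; linarith
    have : 0 ≤ 2 * l ^ 2 * (U x) ^ 2 * (1 - U x) := by positivity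
    linarith
  · refine ⟨l, hl0, fun x => ?_⟩
    have h0 := exp_pos (l * x)
    have : U x = exp (l * x) / (1 + exp (l * x)) := by simp only [U]; field_simp; ring
    rw [this, div_le_iff₀ (by positivity)]
    nlinarith
  · rintro V ⟨ρ, hρ, hV⟩
    let m := min ((σ - 2 * l) / 2) (min l ρ)
    have hm0 : 0 < m := lt_min (by linarith) (lt_min hl0 hρ)
    have hm1 : m ≤ (σ - 2 * l) / 2 := min_le_left _ _
    have hm2 : m ≤ l := (min_le_right _ _).trans (min_le_left _ _)
    have hm3 : m ≤ ρ := (min_le_right _ _).trans (min_le_right _ _)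
    set c0 := m * (σ - 2 * l - m) with hc0
    have hc : 0 < c0 := mul_pos hm0 (by linarith)
    set q := 1 + 3 * κ / c0 with hq
    have hq1 : 1 ≤ q := by
      have : 0 < 3 * κ / c0 := by positivity
      linarith
    have hqc : 3 * κ ≤ q * c0 := by
      rw [hq, add_mul, div_mul_cancel₀ _ hc.ne']; linarith
    let F : ℝ → ℝ := fun x => exp (l * x) - q * exp ((l + m) * x)
    let F' : ℝ → ℝ := fun x => l * exp (l * x) - q * ((l + m) * exp ((l + m) * x))
    let F'' : ℝ → ℝ := fun x => l * (l * exp (l * x)) - q * ((l + m) * ((l + m) * exp ((l + m) * x)))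
    have hF : ∀ t, HasDerivAt F (F' t) t := fun t =>
      (he l t).sub ((he (l + m) t).const_mul q)
    have hF' : ∀ t, HasDerivAt F' (F'' t) t := fun t =>
      ((he l t).const_mul l).sub (((he (l + m) t).const_mul (l + m)).const_mul q)
    have hFc : Continuous F := continuous_iff_continuousAt.2 fun t => (hF t).continuousAt
    have key : ∀ x, 0 < F x → q * exp (m * x) < 1 ∧ x < 0 := by
      intro x hx
      have h1 : F x = exp (l * x) * (1 - q * exp (m * x)) := by
        simp only [F]; rw [add_mul l m x, exp_add]; ring
      rw [h1] at hx
      have h2 := (pos_iff_pos_of_mul_pos hx).1 (exp_pos _)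
      refine ⟨by linarith, ?_⟩
      by_contra hx0
      push Not at hx0
      have : 1 ≤ exp (m * x) := one_le_exp (by positivity)
      nlinarith
    have hUx : ∀ x, U x = exp (l * x) / (1 + exp (l * x)) := by
      intro x; simp only [U]; field_simp; ring
    refine ⟨fun x => max 0 (F x), by fun_prop, fun x => le_max_left _ _, ?_, ?_, ?_⟩
    · intro x
      refine max_le ?_ ?_
      · rw [hUx]; positivity
      · rcases le_or_gt (F x) 0 with hx | hx
        · refine hx.trans ?_
          rw [hUx]; positivity
        · obtain ⟨h1, h2⟩ := key x hx
          have h3 : exp (l * x) ≤ exp (m * x) := exp_le_exp.2 (by nlinarith)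
          have hF1 : F x = exp (l * x) * (1 - q * exp (m * x)) := by
            simp only [F]; rw [add_mul l m x, exp_add]; ring
          rw [hUx, hF1, le_div_iff₀ (by positivity), mul_assoc]
          have h4 := exp_pos (l * x)
          have h5 := exp_pos (m * x)
          have h6 : exp (l * x) ≤ q * exp (m * x) := by nlinarith
          have : (1 - q * exp (m * x)) * (1 + exp (l * x)) ≤ 1 := by nlinarith
          nlinarith
    · refine ⟨-(log (2 * q)) / m, fun x hx => ?_⟩
      rw [le_div_iff₀ hm0] at hx
      have h1 : exp (m * x) ≤ (2 * q)⁻¹ := by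
        rw [← exp_log (show 0 < 2 * q by linarith), ← exp_neg]
        exact exp_le_exp.2 (by linarith)
      have h2 : q * exp (m * x) ≤ 1 / 2 := by
        calc q * exp (m * x) ≤ q * (2 * q)⁻¹ := by gcongr
          _ = 1 / 2 := by field_simp
      have hF1 : F x = exp (l * x) * (1 - q * exp (m * x)) := by
        simp only [F]; rw [add_mul l m x, exp_add]; ring
      refine lt_max_of_lt_right ?_
      rw [hF1]
      exact mul_pos (exp_pos _) (by linarith)
    · intro x hx
      have hx1 : 0 < F x := by
        rcases lt_max_iff.1 hx with h | h
        · exact absurd h (lt_irrefl _)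
        · exact h
      refine ⟨F, F', F'', ?_, hF, hF', ?_⟩
      · filter_upwards [hFc.continuousAt.eventually (lt_mem_nhds hx1)] with y hy
        exact max_eq_right hy.le
      · obtain ⟨h1, h2⟩ := key x hx1
        have e1 : F'' x - σ * F' x + κ * F x = q * c0 * exp ((l + m) * x) := by
          have : F'' x - σ * F' x + κ * F x = (l ^ 2 - σ * l + κ) * (exp (l * x) - q * exp ((l + m) * x)) + q * c0 * exp ((l + m) * x) := by
            simp only [F, F', F'', hc0]; ring
          rw [this, hl1]; ring
        have e2 : F'' x - σ * F' x + κ * F x * (1 - F x - V x) =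
            q * c0 * exp ((l + m) * x) - κ * (F x * (F x + V x)) := by rw [← e1]; ring
        rw [e2]
        have h3 : exp (l * x) ≤ exp (m * x) := exp_le_exp.2 (by nlinarith)
        have h4 : exp (ρ * x) ≤ exp (m * x) := exp_le_exp.2 (by nlinarith)
        have h5 : F x ≤ exp (l * x) := by
          simp only [F]; have : 0 < q * exp ((l + m) * x) := by positivity
          linarith
        have h6 : F x + V x ≤ 3 * exp (m * x) := by linarith [hV x]
        have h7 : F x * (F x + V x) ≤ exp (l * x) * (3 * exp (m * x)) := by
          calc F x * (F x + V x) ≤ F x * (3 * exp (m * x)) := by gcongr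
            _ ≤ _ := by gcongr
        have h8 : exp ((l + m) * x) = exp (l * x) * exp (m * x) := by rw [add_mul, exp_add]
        rw [h8]
        have h9 : 0 < exp (l * x) * exp (m * x) := by positivity
        nlinarith

lemma lv_scalar_crit (σ κ : ℝ) (hσ : 0 < σ) (hκ : 0 < κ) (h : 4 * κ = σ ^ 2) :
    ∃ U U' U'' : ℝ → ℝ, (∀ t, HasDerivAt U (U' t) t) ∧ (∀ t, HasDerivAt U' (U'' t) t) ∧
      (∀ x, 0 < U x) ∧ (∀ x, U x ≤ 1) ∧
      (∀ x, U'' x - σ * U' x + κ * U x * (1 - U x) ≤ 0) ∧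
      (∃ ρ > 0, ∀ x, U x ≤ 2 * exp (ρ * x)) ∧
      (∀ V : ℝ → ℝ, (∃ ρ > 0, ∀ x, V x ≤ 2 * exp (ρ * x)) →
        ∃ L : ℝ → ℝ, Continuous L ∧ (∀ x, 0 ≤ L x) ∧ (∀ x, L x ≤ U x) ∧
          (∃ X, ∀ x ≤ X, 0 < L x) ∧ LVSub σ κ V L) := by
  obtain ⟨l, rfl⟩ : ∃ l : ℝ, σ = 2 * l := ⟨σ / 2, by ring⟩
  have hl0 : 0 < l := by linarith
  obtain rfl : κ = l ^ 2 := by linarith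
  have he : ∀ (r t : ℝ), HasDerivAt (fun x => exp (r * x)) (r * exp (r * t)) t := by
    intro r t
    have := ((hasDerivAt_id t).const_mul r).exp
    simpa [mul_comm] using this
  let S : ℝ → ℝ := fun x => (1 + exp (-l * x))⁻¹
  let U : ℝ → ℝ := fun x => exp (l * x) * log (1 + exp (-l * x))
  have hee : ∀ x, exp (l * x) * exp (-l * x) = 1 := by
    intro x; rw [← exp_add]; simp
  have hS : ∀ t, HasDerivAt S (l * S t * (1 - S t)) t := by
    intro t
    have hp : 1 + exp (-l * t) ≠ 0 := by positivity
    have := ((he (-l) t).const_add 1).fun_inv hp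
    refine this.congr_deriv ?_
    simp only [S]
    field_simp
    ring
  have hU : ∀ t, HasDerivAt U (l * U t - l * S t) t := by
    intro t
    have hp : 1 + exp (-l * t) ≠ 0 := by positivity
    have := (he l t).mul (((he (-l) t).const_add 1).log hp)
    refine this.congr_deriv ?_
    have h1 := hee t
    simp only [U, S]
    set y := exp (-l * t)
    field_simp
    linear_combination -h1
  have hSU : ∀ x, S x ≤ U x := by
    intro x
    have hp : 0 < 1 + exp (-l * x) := by positivity
    have h1 := Real.one_sub_inv_le_log_of_pos hp
    have h2 : S x = exp (l * x) * (1 - (1 + exp (-l * x))⁻¹) := by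
      have h3 := hee x
      simp only [S]; set y := exp (-l * x); field_simp; linear_combination - h3
    rw [h2]
    simp only [U]
    gcongr
  have hS0 : ∀ x, 0 < S x := fun x => by simp only [S]; positivity
  have hU0 : ∀ x, 0 < U x := fun x => (hS0 x).trans_le (hSU x)
  refine ⟨U, fun t => l * U t - l * S t,
    fun t => l * (l * U t - l * S t) - l * (l * S t * (1 - S t)),
    hU, ?_, hU0, ?_, ?_, ?_, ?_⟩
  · intro t
    exact ((hU t).const_mul l).sub ((hS t).const_mul l)
  · intro x
    have h1 := Real.log_le_sub_one_of_pos (show 0 < 1 + exp (-l * x) by positivity)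
    calc U x ≤ exp (l * x) * exp (-l * x) := by simp only [U]; gcongr; linarith
      _ = 1 := hee x
  · intro x
    have e : l * (l * U x - l * S x) - l * (l * S x * (1 - S x)) - 2 * l * (l * U x - l * S x)
      + l ^ 2 * U x * (1 - U x) = l ^ 2 * (S x ^ 2 - U x ^ 2) := by ring
    simp only [e]
    have := pow_le_pow_left₀ (hS0 x).le (hSU x) 2
    have : 0 ≤ l ^ 2 := by positivity
    nlinarith
  · refine ⟨l / 2, by positivity, fun x => ?_⟩
    set y := exp (-l / 2 * x) with hy
    have hy0 : 0 < y := exp_pos _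
    have hy2 : exp (-l * x) = y ^ 2 := by rw [hy, ← exp_nat_mul]; congr 1; push_cast; ring
    have hx2 : exp (l * x) = exp (l / 2 * x) ^ 2 := by rw [← exp_nat_mul]; congr 1; push_cast; ring
    have hxy : exp (l / 2 * x) * y = 1 := by rw [hy, ← exp_add]; ring_nf; simp
    have h1 : log (1 + exp (-l * x)) ≤ 2 * y := by
      rw [hy2]
      have h2 : log (1 + y ^ 2) ≤ log ((1 + y) ^ 2) := log_le_log (by positivity) (by nlinarith)
      have h3 := Real.log_le_sub_one_of_pos (show 0 < 1 + y by positivity)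
      rw [log_pow] at h2
      push_cast at h2
      linarith
    calc U x ≤ exp (l * x) * (2 * y) := by simp only [U]; gcongr
      _ = 2 * exp (l / 2 * x) * (exp (l / 2 * x) * y) := by rw [hx2]; ring
      _ = _ := by rw [hxy]; ring
  · rintro V ⟨ρ, hρ, hV⟩
    let m := min (l / 3) (ρ / 2)
    have hm0 : 0 < m := lt_min (by linarith) (by linarith)
    have hm2 : m ≤ l / 3 := (min_le_left _ _)
    have hm3 : m ≤ ρ / 2 := (min_le_right _ _)
    set q := l ^ 2 * (l / m) * (l / m + 2) / m ^ 2 with hq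
    have hq0 : 0 < q := by positivity
    have hqm : q * m ^ 2 = l ^ 2 * (l / m) * (l / m + 2) := by
      rw [hq, div_mul_cancel₀ _ (by positivity)]
    let F : ℝ → ℝ := fun x => exp (l * x) * (-l * x - q * (1 - exp (m * x)))
    let F' : ℝ → ℝ := fun x => l * F x + exp (l * x) * (-l + q * m * exp (m * x))
    let F'' : ℝ → ℝ := fun x => l * F' x + (l * exp (l * x) * (-l + q * m * exp (m * x)) +
      exp (l * x) * (q * m * (m * exp (m * x))))
    have hF : ∀ t, HasDerivAt F (F' t) t := fun t => by
      have := (he l t).mul (((hasDerivAt_id t).const_mul (-l)).sub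
        (((he m t).const_sub 1).const_mul q))
      refine this.congr_deriv ?_
      simp only [F, F', Pi.sub_apply, id]; ring
    have hF' : ∀ t, HasDerivAt F' (F'' t) t := fun t => by
      have := ((hF t).const_mul l).add ((he l t).mul (((he m t).const_mul (q * m)).const_add (-l)))
      exact this
    have hFc : Continuous F := continuous_iff_continuousAt.2 fun t => (hF t).continuousAt
    have hF0 : F 0 = 0 := by simp [F]
    have hFU : ∀ x ≤ 0, F x ≤ exp (l * x) * (-l * x) := by
      intro x hx
      simp only [F]
      have : exp (m * x) ≤ 1 := exp_le_one_iff.2 (by nlinarith)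
      have : 0 ≤ q * (1 - exp (m * x)) := mul_nonneg hq0.le (by linarith)
      gcongr
      linarith
    have hlU : ∀ x, exp (l * x) * (-l * x) ≤ U x := by
      intro x
      simp only [U]
      gcongr
      rw [Real.le_log_iff_exp_le (by positivity)]
      linarith
    refine ⟨fun x => max 0 (F (min x 0)), by fun_prop, fun x => le_max_left _ _, ?_, ?_, ?_⟩
    · intro x
      refine max_le (hU0 x).le ?_
      rcases le_or_gt x 0 with hx | hx
      · rw [min_eq_left hx]
        exact (hFU x hx).trans (hlU x)
      · rw [min_eq_right hx.le, hF0]; exact (hU0 x).le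
    · refine ⟨-(q / l), fun x hx => ?_⟩
      have hx0 : x < 0 := hx.trans_lt (by have : 0 < q / l := by positivity
                                          linarith)
      have h1 : q ≤ - l * x := by
        have : q / l ≤ -x := by linarith
        rw [div_le_iff₀ hl0] at this
        linarith
      refine lt_max_of_lt_right ?_
      rw [min_eq_left hx0.le]
      refine mul_pos (exp_pos _) ?_
      have : 0 < q * exp (m * x) := by positivity
      linarith
    · intro x hx
      have hx1 : 0 < F (min x 0) := by
        rcases lt_max_iff.1 hx with h | h
        · exact absurd h (lt_irrefl _)
        · exact h
      have hx0 : x < 0 := by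
        by_contra hc
        push Not at hc
        rw [min_eq_right hc, hF0] at hx1
        exact lt_irrefl _ hx1
      rw [min_eq_left hx0.le] at hx1
      refine ⟨F, F', F'', ?_, hF, hF', ?_⟩
      · filter_upwards [hFc.continuousAt.eventually (lt_mem_nhds hx1), gt_mem_nhds hx0] with y hy hy0
        rw [min_eq_left hy0.le]
        exact max_eq_right hy.le
      · have e2 : F'' x - 2 * l * F' x + l ^ 2 * F x * (1 - F x - V x) =
            q * m ^ 2 * (exp (l * x) * exp (m * x)) - l ^ 2 * (F x * (F x + V x)) := by
          simp only [F', F'']; ring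
        rw [e2, hqm]
        have h3 : exp ((l - m) * x) ≤ exp (2 * m * x) := exp_le_exp.2 (by nlinarith)
        have h4 : exp (ρ * x) ≤ exp (2 * m * x) := exp_le_exp.2 (by nlinarith)
        have h5 : F x ≤ l / m * exp ((l - m) * x) := by
          refine (hFU x hx0.le).trans ?_
          have h6 := Real.add_one_le_exp (-m * x)
          have h7 : -l * x ≤ l / m * exp (-m * x) := by
            have : -l * x = l / m * (-m * x) := by field_simp
            rw [this]; gcongr; linarith
          have h8 : exp ((l - m) * x) = exp (l * x) * exp (-m * x) := by
            rw [← exp_add]; congr 1; ring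
          rw [h8]
          calc _ ≤ exp (l * x) * (l / m * exp (-m * x)) := by gcongr
            _ = _ := by ring
        have hlm : 0 < l / m := by positivity
        have h6 : F x + V x ≤ (l / m + 2) * exp (2 * m * x) := by
          have : l / m * exp ((l - m) * x) ≤ l / m * exp (2 * m * x) := by gcongr
          linarith [hV x]
        have h7 : F x * (F x + V x) ≤ (l / m * exp ((l - m) * x)) * ((l / m + 2) * exp (2 * m * x)) := by
          calc F x * (F x + V x) ≤ F x * ((l / m + 2) * exp (2 * m * x)) := by gcongr
            _ ≤ _ := by gcongr
        have h8 : exp ((l - m) * x) * exp (2 * m * x) = exp (l * x) * exp (m * x) := by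
          rw [← exp_add, ← exp_add]; congr 1; ring
        have h9 : (l / m * exp ((l - m) * x)) * ((l / m + 2) * exp (2 * m * x)) =
          (l / m) * (l / m + 2) * (exp (l * x) * exp (m * x)) := by rw [← h8]; ring
        rw [h9] at h7
        have := mul_le_mul_of_nonneg_left h7 (sq_nonneg l)
        linarith

lemma lv_scalar (σ κ : ℝ) (hσ : 0 < σ) (hκ : 0 < κ) (h : 4 * κ ≤ σ ^ 2) :
    ∃ U U' U'' : ℝ → ℝ, (∀ t, HasDerivAt U (U' t) t) ∧ (∀ t, HasDerivAt U' (U'' t) t) ∧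
      (∀ x, 0 < U x) ∧ (∀ x, U x ≤ 1) ∧
      (∀ x, U'' x - σ * U' x + κ * U x * (1 - U x) ≤ 0) ∧
      (∃ ρ > 0, ∀ x, U x ≤ 2 * exp (ρ * x)) ∧
      (∀ V : ℝ → ℝ, (∃ ρ > 0, ∀ x, V x ≤ 2 * exp (ρ * x)) →
        ∃ L : ℝ → ℝ, Continuous L ∧ (∀ x, 0 ≤ L x) ∧ (∀ x, L x ≤ U x) ∧
          (∃ X, ∀ x ≤ X, 0 < L x) ∧ LVSub σ κ V L) := by
  rcases h.lt_or_eq with h | h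
  · exact lv_scalar_noncrit σ κ hσ hκ h
  · exact lv_scalar_crit σ κ hσ hκ h

/-- forward resolvent -/
noncomputable def lvA (p : ℝ) (H : ℝ → ℝ) (x : ℝ) : ℝ :=
  ∫ t in Set.Ioi (0:ℝ), exp (-p * t) * H (x + t)

/-- backward resolvent -/
noncomputable def lvB (p : ℝ) (H : ℝ → ℝ) (x : ℝ) : ℝ := lvA p (fun y => H (-y)) (-x)

lemma lvA_int {p M : ℝ} (hp : 0 < p) {H : ℝ → ℝ} (hc : Continuous H) (hM : ∀ x, |H x| ≤ M) (x : ℝ) :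
    MeasureTheory.IntegrableOn (fun t => exp (-p * t) * H (x + t)) (Set.Ioi (0:ℝ)) := by
  have h1 := (exp_neg_integrableOn_Ioi 0 hp).mul_const M
  refine h1.mono' (by fun_prop) ?_
  refine Filter.Eventually.of_forall fun t => ?_
  rw [norm_mul, Real.norm_eq_abs, Real.norm_eq_abs, abs_exp]
  gcongr
  exact hM _

lemma lvA_mono {p M M' : ℝ} (hp : 0 < p) {H G : ℝ → ℝ} (hc : Continuous H) (hM : ∀ x, |H x| ≤ M)
    (hc' : Continuous G) (hM' : ∀ x, |G x| ≤ M') (hle : ∀ x, H x ≤ G x) (x : ℝ) :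
    lvA p H x ≤ lvA p G x := by
  refine MeasureTheory.integral_mono (lvA_int hp hc hM x) (lvA_int hp hc' hM' x) fun t => ?_
  have := hle (x + t)
  dsimp only
  gcongr

lemma lvA_const {p : ℝ} (hp : 0 < p) (M x : ℝ) : lvA p (fun _ => M) x = M / p := by
  unfold lvA
  rw [MeasureTheory.integral_mul_const, integral_exp_mul_Ioi (by linarith)]
  simp
  field_simp

lemma lvA_bound {p M : ℝ} (hp : 0 < p) {H : ℝ → ℝ} (hc : Continuous H) (hM : ∀ x, |H x| ≤ M) (x : ℝ) :
    |lvA p H x| ≤ M / p := by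
  have hM0 : 0 ≤ M := (abs_nonneg _).trans (hM 0)
  rw [abs_le]
  constructor
  · rw [← neg_div, ← lvA_const hp (-M) x]
    exact lvA_mono hp continuous_const (M := M) (fun x => by simp [abs_of_nonneg hM0]) hc hM (fun x => (abs_le.1 (hM x)).1) x
  · rw [← lvA_const hp M x]
    exact lvA_mono hp hc hM continuous_const (M' := M) (fun x => by simp [abs_of_nonneg hM0]) (fun x => (abs_le.1 (hM x)).2) x

lemma lvA_deriv {p M : ℝ} (hp : 0 < p) {H : ℝ → ℝ} (hc : Continuous H) (hM : ∀ x, |H x| ≤ M) (x : ℝ) :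
    HasDerivAt (lvA p H) (p * lvA p H x - H x) x := by
  have hint : ∀ a, MeasureTheory.IntegrableOn (fun t => exp (-p * t) * H t) (Set.Ioi a) := by
    intro a
    have h1 := (exp_neg_integrableOn_Ioi a hp).mul_const M
    refine h1.mono' (by fun_prop) ?_
    refine Filter.Eventually.of_forall fun t => ?_
    rw [norm_mul, Real.norm_eq_abs, Real.norm_eq_abs, abs_exp]
    gcongr
    exact hM _
  have hform : ∀ y, lvA p H y = exp (p * y) *
      ((∫ t in Set.Ioi (0:ℝ), exp (-p * t) * H t) - ∫ t in (0:ℝ)..y, exp (-p * t) * H t) := by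
    intro y
    have h1 := intervalIntegral.integral_interval_add_Ioi (hint 0) (hint y)
    have h2 : lvA p H y = ∫ t in Set.Ioi (0:ℝ), exp (p * y) * (exp (-p * (t + y)) * H (t + y)) := by
      unfold lvA
      congr 1
      ext t
      rw [← mul_assoc, ← exp_add, add_comm y t]
      congr 2
      ring
    have h3 := (MeasureTheory.measurePreserving_add_right MeasureTheory.volume y).setIntegral_preimage_emb
      (measurableEmbedding_addRight y) (fun t => exp (-p * t) * H t) (Set.Ioi y)
    have h4 : (fun x : ℝ => x + y) ⁻¹' Set.Ioi y = Set.Ioi 0 := by ext t; simp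
    rw [h4] at h3
    rw [h2, MeasureTheory.integral_const_mul, h3, ← h1]
    ring
  have hcont : Continuous (fun t => exp (-p * t) * H t) := by fun_prop
  have hd := intervalIntegral.integral_hasDerivAt_right (hcont.intervalIntegrable 0 x)
    (hcont.stronglyMeasurableAtFilter _ _) hcont.continuousAt
  have he : HasDerivAt (fun x => exp (p * x)) (p * exp (p * x)) x := by
    have := ((hasDerivAt_id x).const_mul p).exp
    simpa [mul_comm] using this
  have := he.mul (hd.const_sub (∫ t in Set.Ioi (0:ℝ), exp (-p * t) * H t))
  have hf : lvA p H = (fun y => exp (p * y) *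
      ((∫ t in Set.Ioi (0:ℝ), exp (-p * t) * H t) - ∫ t in (0:ℝ)..y, exp (-p * t) * H t)) :=
    funext hform
  rw [hf]
  refine this.congr_deriv ?_
  have e : exp (p * x) * exp (-p * x) = 1 := by rw [← exp_add]; simp
  linear_combination (- H x) * e

lemma lvA_tendsto {p M : ℝ} (hp : 0 < p) {H : ℕ → ℝ → ℝ} {G : ℝ → ℝ} (hc : ∀ n, Continuous (H n))
    (hM : ∀ n x, |H n x| ≤ M) (hG : ∀ x, Tendsto (fun n => H n x) atTop (nhds (G x))) (x : ℝ) :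
    Tendsto (fun n => lvA p (H n) x) atTop (nhds (lvA p G x)) := by
  refine MeasureTheory.tendsto_integral_of_dominated_convergence
    (fun t => exp (-p * t) * M) ?_ ((exp_neg_integrableOn_Ioi 0 hp).mul_const M) ?_ ?_
  · intro n
    have := hc n
    exact Continuous.aestronglyMeasurable (by fun_prop)
  · intro n
    refine Filter.Eventually.of_forall fun t => ?_
    rw [norm_mul, Real.norm_eq_abs, Real.norm_eq_abs, abs_exp]
    gcongr
    exact hM _ _
  · exact Filter.Eventually.of_forall fun t => (hG _).const_mul _

lemma lvB_deriv {p M : ℝ} (hp : 0 < p) {H : ℝ → ℝ} (hc : Continuous H) (hM : ∀ x, |H x| ≤ M) (x : ℝ) :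
    HasDerivAt (lvB p H) (H x - p * lvB p H x) x := by
  have h1 := lvA_deriv hp (H := fun y => H (-y)) (by fun_prop) (fun x => hM _) (-x)
  have h2 := HasDerivAt.scomp (𝕜 := ℝ) x h1 (hasDerivAt_neg x)
  refine h2.congr_deriv ?_
  simp [lvB]

/-- the solution operator of `y'' - σ y' - 2σ² y = -H` -/
noncomputable def lvT (σ : ℝ) (H : ℝ → ℝ) : ℝ → ℝ := lvB σ (lvA (2 * σ) H)

lemma lvA_cont {p M : ℝ} (hp : 0 < p) {H : ℝ → ℝ} (hc : Continuous H) (hM : ∀ x, |H x| ≤ M) :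
    Continuous (lvA p H) := continuous_iff_continuousAt.2 fun x => (lvA_deriv hp hc hM x).continuousAt

lemma lvT_spec {σ M : ℝ} (hσ : 0 < σ) {H : ℝ → ℝ} (hc : Continuous H) (hM : ∀ x, |H x| ≤ M) :
    (∀ x, HasDerivAt (lvT σ H) (lvA (2 * σ) H x - σ * lvT σ H x) x) ∧
    (∀ x, HasDerivAt (fun x => lvA (2 * σ) H x - σ * lvT σ H x)
      (σ * (lvA (2 * σ) H x - σ * lvT σ H x) + 2 * σ ^ 2 * lvT σ H x - H x) x) ∧
    (∀ x, |lvT σ H x| ≤ M / (2 * σ) / σ) := by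
  have h2 : 0 < 2 * σ := by linarith
  have hb := lvA_bound h2 hc hM
  have hcA := lvA_cont h2 hc hM
  have h1 : ∀ x, HasDerivAt (lvT σ H) (lvA (2 * σ) H x - σ * lvT σ H x) x :=
    fun x => lvB_deriv hσ hcA hb x
  refine ⟨h1, fun x => ?_, fun x => ?_⟩
  · refine ((lvA_deriv h2 hc hM x).sub ((h1 x).const_mul σ)).congr_deriv ?_
    ring
  · exact lvA_bound hσ (H := fun y => lvA (2 * σ) H (-y)) (by fun_prop) (fun y => hb _) (-x)

lemma lvT_mono {σ M M' : ℝ} (hσ : 0 < σ) {H G : ℝ → ℝ} (hc : Continuous H) (hM : ∀ x, |H x| ≤ M)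
    (hc' : Continuous G) (hM' : ∀ x, |G x| ≤ M') (hle : ∀ x, H x ≤ G x) (x : ℝ) :
    lvT σ H x ≤ lvT σ G x := by
  have h2 : 0 < 2 * σ := by linarith
  have h3 := lvA_cont h2 hc hM
  have h4 := lvA_cont h2 hc' hM'
  exact lvA_mono hσ (by fun_prop) (fun y => lvA_bound h2 hc hM (-y)) (by fun_prop)
    (fun y => lvA_bound h2 hc' hM' (-y)) (fun y => lvA_mono h2 hc hM hc' hM' hle (-y)) (-x)

lemma lvT_tendsto {σ M : ℝ} (hσ : 0 < σ) {H : ℕ → ℝ → ℝ} {G : ℝ → ℝ} (hc : ∀ n, Continuous (H n))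
    (hM : ∀ n x, |H n x| ≤ M) (hG : ∀ x, Tendsto (fun n => H n x) atTop (nhds (G x))) (x : ℝ) :
    Tendsto (fun n => lvT σ (H n) x) atTop (nhds (lvT σ G x)) := by
  have h2 : 0 < 2 * σ := by linarith
  have h3 := fun n => lvA_cont h2 (hc n) (hM n)
  refine lvA_tendsto hσ (H := fun n y => lvA (2 * σ) (H n) (-y)) (M := M / (2 * σ))
    (fun n => ?_) (fun n y => lvA_bound h2 (hc n) (hM n) (-y)) (fun y => lvA_tendsto h2 hc hM hG (-y)) (-x)
  have := h3 n
  fun_prop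

/-- second derivative test -/
lemma lv_second {g g' g'' : ℝ → ℝ} {x : ℝ} (hg : ∀ t, HasDerivAt g (g' t) t)
    (hg' : ∀ t, HasDerivAt g' (g'' t) t) (hx : IsLocalMax g x) : g' x = 0 ∧ g'' x ≤ 0 := by
  have h0 : g' x = 0 := hx.hasDerivAt_eq_zero (hg x)
  refine ⟨h0, ?_⟩
  by_contra hc
  push Not at hc
  have e1 : deriv g = g' := funext fun t => (hg t).deriv
  have e2 : deriv (deriv g) x = g'' x := by rw [e1]; exact (hg' x).deriv
  have hmin : IsLocalMin g x := isLocalMin_of_deriv_deriv_pos (by rw [e2]; exact hc)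
    (by rw [e1]; exact h0) (hg x).continuousAt
  have hcst : g =ᶠ[nhds x] fun _ => g x := by
    filter_upwards [hx, hmin] with y h1 h2 using le_antisymm h1 h2
  have h3 : deriv g =ᶠ[nhds x] deriv (fun _ => g x) := hcst.deriv
  have h4 := h3.deriv_eq
  rw [e2] at h4
  simp at h4
  linarith

/-- maximum principle -/
lemma lv_maxprinciple {σ β M : ℝ} (hσ : 0 < σ) (hβ : β = 2 * σ ^ 2) {z : ℝ → ℝ} (hc : Continuous z)
    (hM : ∀ x, z x ≤ M)
    (h : ∀ x, 0 < z x → ∃ g g' g'' : ℝ → ℝ, z =ᶠ[nhds x] g ∧ (∀ t, HasDerivAt g (g' t) t) ∧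
      (∀ t, HasDerivAt g' (g'' t) t) ∧ 0 ≤ g'' x - σ * g' x - β * g x) (x : ℝ) : z x ≤ 0 := by
  by_contra hx
  push Not at hx
  set η := σ / 2 with hη
  have hη0 : 0 < η := by positivity
  let C : ℝ → ℝ := fun t => exp (η * t) + exp (-η * t)
  let C' : ℝ → ℝ := fun t => η * exp (η * t) + -η * exp (-η * t)
  let C'' : ℝ → ℝ := fun t => η * (η * exp (η * t)) + -η * (-η * exp (-η * t))
  have he : ∀ (r t : ℝ), HasDerivAt (fun x => exp (r * x)) (r * exp (r * t)) t := by
    intro r t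
    have := ((hasDerivAt_id t).const_mul r).exp
    simpa [mul_comm] using this
  have hC : ∀ t, HasDerivAt C (C' t) t := fun t => (he η t).add (he (-η) t)
  have hC' : ∀ t, HasDerivAt C' (C'' t) t := fun t =>
    ((he η t).const_mul η).add ((he (-η) t).const_mul (-η))
  have hC0 : ∀ t, 0 < C t := fun t => by simp only [C]; positivity
  have hCc : Continuous C := by simp only [C]; fun_prop
  have hClow : ∀ t, η * |t| ≤ C t := by
    intro t
    rcases abs_cases t with ⟨h1, _⟩ | ⟨h1, _⟩ <;> rw [h1] <;> simp only [C]
    · linarith [add_one_le_exp (η * t), exp_pos (-η * t)]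
    · linarith [add_one_le_exp (-η * t), exp_pos (η * t)]
  set ε := z x / (2 * C x) with hε
  have hε0 : 0 < ε := div_pos hx (by linarith [hC0 x])
  let y : ℝ → ℝ := fun t => z t - ε * C t
  have hyx : 0 < y x := by
    have : ε * C x = z x / 2 := by rw [hε]; field_simp [(hC0 x).ne']
    simp only [y]; linarith
  have hyc : Continuous y := by simp only [y]; fun_prop
  have hR : ∀ t, M / (ε * η) < |t| → y t < y x := by
    intro t ht
    rw [div_lt_iff₀ (by positivity)] at ht
    have h1 := hM t
    have h2 : ε * (η * |t|) ≤ ε * C t := by gcongr; exact hClow t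
    have : y t < 0 := by simp only [y]; nlinarith
    linarith
  obtain ⟨x1, hx1⟩ : ∃ x1, ∀ t, y t ≤ y x1 := by
    refine Continuous.exists_forall_ge' hyc x ?_
    have : ∀ᶠ t in Filter.cocompact ℝ, M / (ε * η) < |t| := by
      have := tendsto_norm_cocompact_atTop (E := ℝ)
      exact this.eventually_gt_atTop _
    filter_upwards [this] with t ht using (hR t ht).le
  have hy1 : 0 < y x1 := hyx.trans_le (hx1 x)
  have hz1 : 0 < z x1 := by
    have := mul_pos hε0 (hC0 x1)
    simp only [y] at hy1; linarith
  obtain ⟨g, g', g'', hzg, hg, hg', hineq⟩ := h x1 hz1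
  have hloc : IsLocalMax (fun t => g t - ε * C t) x1 := by
    filter_upwards [hzg] with t ht
    have := hx1 t
    simp only [y] at this
    rw [← ht, ← hzg.eq_of_nhds]
    exact this
  obtain ⟨h1, h2⟩ := lv_second (g := fun t => g t - ε * C t) (g' := fun t => g' t - ε * C' t)
    (g'' := fun t => g'' t - ε * C'' t)
    (fun t => (hg t).sub ((hC t).const_mul ε)) (fun t => (hg' t).sub ((hC' t).const_mul ε)) hloc
  have hgz : g x1 = z x1 := hzg.eq_of_nhds.symm
  have h3 : C'' x1 - σ * C' x1 - β * C x1 < 0 := by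
    have e1 := exp_pos (η * x1)
    have e2 := exp_pos (-η * x1)
    have hs : σ = 2 * η := by rw [hη]; ring
    have : C'' x1 - σ * C' x1 - β * C x1 = - (9 * η ^ 2) * exp (η * x1) - 5 * η ^ 2 * exp (-η * x1) := by
      simp only [C, C', C'', hβ, hs]; ring
    rw [this]
    have : 0 < 9 * η ^ 2 * exp (η * x1) := by positivity
    have : 0 < 5 * η ^ 2 * exp (-η * x1) := by positivity
    linarith
  have h4 : 0 < β * y x1 := by rw [hβ]; positivity
  have h5 : ε * (C'' x1 - σ * C' x1 - β * C x1) < 0 := mul_neg_of_pos_of_neg hε0 h3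
  simp only [y] at h4
  rw [← hgz] at h4
  have h6 : g' x1 = ε * C' x1 := by linarith
  rw [h6] at hineq
  linarith

/-- shifted reaction term -/
noncomputable def lvH (σ κ γ : ℝ) (w z : ℝ → ℝ) (x : ℝ) : ℝ :=
  2 * σ ^ 2 * w x + κ * w x * (1 - w x - γ * z x)

lemma lvH_cont {σ κ γ : ℝ} {w z : ℝ → ℝ} (hw : Continuous w) (hz : Continuous z) :
    Continuous (lvH σ κ γ w z) := by unfold lvH; fun_prop

lemma lvH_nonneg {σ κ γ : ℝ} (hκ : 0 < κ) (h : 4 * κ ≤ σ ^ 2) (hγ : 0 ≤ γ) (hγ1 : γ ≤ 1)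
    {w z : ℝ → ℝ} (x : ℝ) (hw : 0 ≤ w x) (hw1 : w x ≤ 1) (hz : 0 ≤ z x) (hz1 : z x ≤ 1) :
    0 ≤ lvH σ κ γ w z x := by
  have h1 : γ * z x ≤ 1 := by nlinarith
  have : lvH σ κ γ w z x = w x * (2 * σ ^ 2 + κ * (1 - w x - γ * z x)) := by unfold lvH; ring
  rw [this]
  refine mul_nonneg hw ?_
  nlinarith

lemma lvH_bound {σ κ γ : ℝ} (hκ : 0 < κ) (h : 4 * κ ≤ σ ^ 2) (hγ : 0 ≤ γ) (hγ1 : γ ≤ 1)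
    {w z : ℝ → ℝ} (x : ℝ) (hw : 0 ≤ w x) (hw1 : w x ≤ 1) (hz : 0 ≤ z x) (hz1 : z x ≤ 1) :
    |lvH σ κ γ w z x| ≤ 2 * σ ^ 2 + κ := by
  rw [abs_of_nonneg (lvH_nonneg hκ h hγ hγ1 x hw hw1 hz hz1)]
  have h1 : 0 ≤ γ * z x := mul_nonneg hγ hz
  have h2 : w x * (1 - w x - γ * z x) ≤ 1 := by nlinarith
  unfold lvH
  nlinarith [sq_nonneg σ]

lemma lvH_mono {σ κ γ : ℝ} (hκ : 0 < κ) (h : 4 * κ ≤ σ ^ 2) (hγ : 0 ≤ γ) (hγ1 : γ ≤ 1)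
    {w z w' z' : ℝ → ℝ} (x : ℝ) (hw : 0 ≤ w x) (hww : w x ≤ w' x) (hw1 : w' x ≤ 1)
    (hz : 0 ≤ z' x) (hzz : z' x ≤ z x) (hz1 : z x ≤ 1) :
    lvH σ κ γ w z x ≤ lvH σ κ γ w' z' x := by
  have h1 : γ * z' x ≤ γ * z x := by gcongr
  have h2 : γ * z x ≤ 1 := by nlinarith
  have e : lvH σ κ γ w' z' x - lvH σ κ γ w z x =
    (w' x - w x) * (2 * σ ^ 2 + κ * (1 - w x - w' x - γ * z x)) +
      κ * w' x * (γ * z x - γ * z' x) := by unfold lvH; ring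
  have h3 : 0 ≤ 2 * σ ^ 2 + κ * (1 - w x - w' x - γ * z x) := by nlinarith
  have h4 : 0 ≤ (w' x - w x) * (2 * σ ^ 2 + κ * (1 - w x - w' x - γ * z x)) :=
    mul_nonneg (by linarith) h3
  have h5 : 0 ≤ κ * w' x * (γ * z x - γ * z' x) :=
    mul_nonneg (mul_nonneg hκ.le (by linarith)) (by linarith)
  linarith

lemma lvT_nonneg {σ M : ℝ} (hσ : 0 < σ) {H : ℝ → ℝ} (hc : Continuous H) (hM : ∀ x, |H x| ≤ M)
    (h0 : ∀ x, 0 ≤ H x) (x : ℝ) : 0 ≤ lvT σ H x := by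
  have h1 := lvT_mono hσ (H := fun _ => 0) (M := 0) continuous_const (by simp) hc hM h0 x
  have h2 : lvT σ (fun _ => 0) x = 0 := by simp [lvT, lvB, lvA]
  linarith

lemma lv_sub_le {σ κ γ : ℝ} (hσ : 0 < σ) (hκ : 0 < κ) (h : 4 * κ ≤ σ ^ 2) (hγ : 0 ≤ γ) (hγ1 : γ ≤ 1)
    {L V : ℝ → ℝ} (hL : Continuous L) (hV : Continuous V) (hL0 : ∀ x, 0 ≤ L x) (hL1 : ∀ x, L x ≤ 1)
    (hV0 : ∀ x, 0 ≤ V x) (hV1 : ∀ x, V x ≤ 1) (hs : LVSub σ κ V L) (x : ℝ) :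
    L x ≤ lvT σ (lvH σ κ γ L V) x := by
  have hc := lvH_cont (σ := σ) (κ := κ) (γ := γ) hL hV
  have hM : ∀ x, |lvH σ κ γ L V x| ≤ 2 * σ ^ 2 + κ := fun x =>
    lvH_bound hκ h hγ hγ1 x (hL0 x) (hL1 x) (hV0 x) (hV1 x)
  have hp := lvT_nonneg hσ hc hM (fun x => lvH_nonneg hκ h hγ hγ1 x (hL0 x) (hL1 x) (hV0 x) (hV1 x))
  obtain ⟨d1, d2, -⟩ := lvT_spec hσ hc hM
  have hTc : Continuous (lvT σ (lvH σ κ γ L V)) :=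
    continuous_iff_continuousAt.2 fun x => (d1 x).continuousAt
  suffices hz : L x - lvT σ (lvH σ κ γ L V) x ≤ 0 by linarith
  refine lv_maxprinciple hσ (M := 1) rfl (z := fun x => L x - lvT σ (lvH σ κ γ L V) x) (by fun_prop)
    (fun x => by linarith [hL1 x, hp x]) ?_ x
  intro x hx
  have hLx : 0 < L x := by linarith [hp x]
  obtain ⟨g, g', g'', hLg, hg, hg', hin⟩ := hs x hLx
  refine ⟨_, _, _, ?_, fun t => (hg t).sub (d1 t), fun t => (hg' t).sub (d2 t), ?_⟩
  · filter_upwards [hLg] with t ht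
    rw [ht]; rfl
  · have e := hLg.eq_of_nhds
    rw [← e] at hin
    simp only [Pi.sub_apply]
    rw [← e]
    unfold lvH
    have : 0 ≤ κ * L x * V x * (1 - γ) :=
      mul_nonneg (mul_nonneg (mul_nonneg hκ.le (hL0 x)) (hV0 x)) (by linarith)
    nlinarith

lemma lv_super_ge {σ κ γ : ℝ} (hσ : 0 < σ) (hκ : 0 < κ) (h : 4 * κ ≤ σ ^ 2) (hγ : 0 ≤ γ) (hγ1 : γ ≤ 1)
    {U U' U'' V : ℝ → ℝ} (hU : ∀ t, HasDerivAt U (U' t) t) (hU' : ∀ t, HasDerivAt U' (U'' t) t)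
    (hV : Continuous V) (hU0 : ∀ x, 0 < U x) (hU1 : ∀ x, U x ≤ 1)
    (hV0 : ∀ x, 0 ≤ V x) (hV1 : ∀ x, V x ≤ 1)
    (hs : ∀ x, U'' x - σ * U' x + κ * U x * (1 - U x) ≤ 0) (x : ℝ) :
    lvT σ (lvH σ κ γ U V) x ≤ U x := by
  have hUc : Continuous U := continuous_iff_continuousAt.2 fun x => (hU x).continuousAt
  have hc := lvH_cont (σ := σ) (κ := κ) (γ := γ) hUc hV
  have hM : ∀ x, |lvH σ κ γ U V x| ≤ 2 * σ ^ 2 + κ := fun x =>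
    lvH_bound hκ h hγ hγ1 x (hU0 x).le (hU1 x) (hV0 x) (hV1 x)
  obtain ⟨d1, d2, d3⟩ := lvT_spec hσ hc hM
  have hTc : Continuous (lvT σ (lvH σ κ γ U V)) :=
    continuous_iff_continuousAt.2 fun x => (d1 x).continuousAt
  suffices hz : lvT σ (lvH σ κ γ U V) x - U x ≤ 0 by linarith
  refine lv_maxprinciple hσ (M := (2 * σ ^ 2 + κ) / (2 * σ) / σ) rfl
    (z := fun x => lvT σ (lvH σ κ γ U V) x - U x) (by fun_prop)
    (fun x => by linarith [hU0 x, (abs_le.1 (d3 x)).2]) ?_ x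
  intro x hx
  refine ⟨_, _, _, Filter.EventuallyEq.rfl, fun t => (d1 t).sub (hU t), fun t => (d2 t).sub (hU' t), ?_⟩
  unfold lvH
  have : 0 ≤ κ * U x * (γ * V x) :=
      mul_nonneg (mul_nonneg hκ.le (hU0 x).le) (mul_nonneg hγ (hV0 x))
  have := hs x
  nlinarith

lemma lv_lip {σ κ γ : ℝ} (hσ : 0 < σ) (hκ : 0 < κ) (h : 4 * κ ≤ σ ^ 2) (hγ : 0 ≤ γ) (hγ1 : γ ≤ 1)
    {w z : ℝ → ℝ} (hw : Continuous w) (hz : Continuous z) (hw0 : ∀ x, 0 ≤ w x) (hw1 : ∀ x, w x ≤ 1)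
    (hz0 : ∀ x, 0 ≤ z x) (hz1 : ∀ x, z x ≤ 1) (x y : ℝ) :
    |lvT σ (lvH σ κ γ w z) x - lvT σ (lvH σ κ γ w z) y| ≤ (2 * σ ^ 2 + κ) / σ * |x - y| := by
  have hc := lvH_cont (σ := σ) (κ := κ) (γ := γ) hw hz
  have hM : ∀ x, |lvH σ κ γ w z x| ≤ 2 * σ ^ 2 + κ := fun x =>
    lvH_bound hκ h hγ hγ1 x (hw0 x) (hw1 x) (hz0 x) (hz1 x)
  obtain ⟨d1, d2, d3⟩ := lvT_spec hσ hc hM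
  have hb := lvA_bound (p := 2 * σ) (by linarith) hc hM
  have := Convex.norm_image_sub_le_of_norm_hasDerivWithin_le (s := Set.univ)
    (f := lvT σ (lvH σ κ γ w z)) (C := (2 * σ ^ 2 + κ) / σ) (x := y) (y := x)
    (fun t _ => (d1 t).hasDerivWithinAt) (fun t _ => ?_) convex_univ trivial trivial
  · simpa using this
  · have h1 := hb t
    have h2 := d3 t
    rw [Real.norm_eq_abs]
    refine (abs_sub _ _).trans ?_
    rw [abs_mul, abs_of_pos hσ]
    have h3 : σ * |lvT σ (lvH σ κ γ w z) t| ≤ σ * ((2 * σ ^ 2 + κ) / (2 * σ) / σ) := by gcongr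
    have h4 : σ * ((2 * σ ^ 2 + κ) / (2 * σ) / σ) = (2 * σ ^ 2 + κ) / (2 * σ) := by field_simp
    have h5 : (2 * σ ^ 2 + κ) / σ = (2 * σ ^ 2 + κ) / (2 * σ) + (2 * σ ^ 2 + κ) / (2 * σ) := by
      field_simp; norm_num
    linarith

lemma lv_fixed {σ₁ κ₁ γ₁ σ₂ κ₂ γ₂ : ℝ} (hσ₁ : 0 < σ₁) (hκ₁ : 0 < κ₁) (h₁ : 4 * κ₁ ≤ σ₁ ^ 2)
    (hγ₁ : 0 ≤ γ₁) (hγ₁1 : γ₁ ≤ 1)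
    (hσ₂ : 0 < σ₂) (hκ₂ : 0 < κ₂) (h₂ : 4 * κ₂ ≤ σ₂ ^ 2) (hγ₂ : 0 ≤ γ₂) (hγ₂1 : γ₂ ≤ 1)
    {U U' U'' V V' V'' L K : ℝ → ℝ}
    (hU : ∀ t, HasDerivAt U (U' t) t) (hU' : ∀ t, HasDerivAt U' (U'' t) t)
    (hU0 : ∀ x, 0 < U x) (hU1 : ∀ x, U x ≤ 1)
    (hUs : ∀ x, U'' x - σ₁ * U' x + κ₁ * U x * (1 - U x) ≤ 0)
    (hV : ∀ t, HasDerivAt V (V' t) t) (hV' : ∀ t, HasDerivAt V' (V'' t) t)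
    (hV0 : ∀ x, 0 < V x) (hV1 : ∀ x, V x ≤ 1)
    (hVs : ∀ x, V'' x - σ₂ * V' x + κ₂ * V x * (1 - V x) ≤ 0)
    (hL : Continuous L) (hL0 : ∀ x, 0 ≤ L x) (hLU : ∀ x, L x ≤ U x) (hLs : LVSub σ₁ κ₁ V L)
    (hK : Continuous K) (hK0 : ∀ x, 0 ≤ K x) (hKV : ∀ x, K x ≤ V x) (hKs : LVSub σ₂ κ₂ U K) :
    ∃ u v : ℝ → ℝ, Continuous u ∧ Continuous v ∧ (∀ x, L x ≤ u x) ∧ (∀ x, u x ≤ U x) ∧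
      (∀ x, K x ≤ v x) ∧ (∀ x, v x ≤ V x) ∧
      u = lvT σ₁ (lvH σ₁ κ₁ γ₁ u v) ∧ v = lvT σ₂ (lvH σ₂ κ₂ γ₂ v u) := by
  have hUc : Continuous U := continuous_iff_continuousAt.2 fun x => (hU x).continuousAt
  have hVc : Continuous V := continuous_iff_continuousAt.2 fun x => (hV x).continuousAt
  -- one-component monotonicity
  have hmono : ∀ {σ κ γ : ℝ}, 0 < σ → 0 < κ → 4 * κ ≤ σ ^ 2 → 0 ≤ γ → γ ≤ 1 →
      ∀ {w z w' z' : ℝ → ℝ}, Continuous w → Continuous z → Continuous w' → Continuous z' →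
      (∀ x, 0 ≤ w x) → (∀ x, w x ≤ w' x) → (∀ x, w' x ≤ 1) →
      (∀ x, 0 ≤ z' x) → (∀ x, z' x ≤ z x) → (∀ x, z x ≤ 1) →
      ∀ x, lvT σ (lvH σ κ γ w z) x ≤ lvT σ (lvH σ κ γ w' z') x := by
    intro σ κ γ a1 a2 a3 a4 a5 w z w' z' c1 c2 c3 c4 b1 b2 b3 b4 b5 b6
    refine lvT_mono a1 (lvH_cont c1 c2) (M := 2 * σ ^ 2 + κ) (M' := 2 * σ ^ 2 + κ) ?_ (lvH_cont c3 c4) ?_ ?_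
    · exact fun x => lvH_bound a2 a3 a4 a5 x (b1 x) ((b2 x).trans (b3 x)) ((b4 x).trans (b5 x)) (b6 x)
    · exact fun x => lvH_bound a2 a3 a4 a5 x ((b1 x).trans (b2 x)) (b3 x) (b4 x) ((b5 x).trans (b6 x))
    · exact fun x => lvH_mono a2 a3 a4 a5 x (b1 x) (b2 x) (b3 x) (b4 x) (b5 x) (b6 x)
  have hTcont : ∀ {σ κ γ : ℝ}, 0 < σ → 0 < κ → 4 * κ ≤ σ ^ 2 → 0 ≤ γ → γ ≤ 1 →
      ∀ {w z : ℝ → ℝ}, Continuous w → Continuous z → 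
      (∀ x, 0 ≤ w x) → (∀ x, w x ≤ 1) → (∀ x, 0 ≤ z x) → (∀ x, z x ≤ 1) →
      Continuous (lvT σ (lvH σ κ γ w z)) := by
    intro σ κ γ a1 a2 a3 a4 a5 w z c1 c2 b1 b2 b3 b4
    have := (lvT_spec a1 (lvH_cont (σ := σ) (κ := κ) (γ := γ) c1 c2)
      fun x => lvH_bound a2 a3 a4 a5 x (b1 x) (b2 x) (b3 x) (b4 x)).1
    exact continuous_iff_continuousAt.2 fun x => (this x).continuousAt
  let Φ : (ℝ → ℝ) × (ℝ → ℝ) → (ℝ → ℝ) × (ℝ → ℝ) := fun P =>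
    (lvT σ₁ (lvH σ₁ κ₁ γ₁ P.1 P.2), lvT σ₂ (lvH σ₂ κ₂ γ₂ P.2 P.1))
  let S : ℕ → (ℝ → ℝ) × (ℝ → ℝ) := fun n => Φ^[n] (U, K)
  have hS0 : S 0 = (U, K) := rfl
  have hS : ∀ n, S (n + 1) = Φ (S n) := fun n => Function.iterate_succ_apply' Φ n _
  have hL1 : ∀ x, L x ≤ 1 := fun x => (hLU x).trans (hU1 x)
  have hK1 : ∀ x, K x ≤ 1 := fun x => (hKV x).trans (hV1 x)
  have hU0' : ∀ x, 0 ≤ U x := fun x => (hU0 x).le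
  have hV0' : ∀ x, 0 ≤ V x := fun x => (hV0 x).le
  have hinv : ∀ n, Continuous (S n).1 ∧ Continuous (S n).2 ∧ (∀ x, L x ≤ (S n).1 x) ∧
      (∀ x, (S n).1 x ≤ U x) ∧ (∀ x, K x ≤ (S n).2 x) ∧ (∀ x, (S n).2 x ≤ V x) := by
    intro n
    induction n with
    | zero => exact ⟨hUc, hK, hLU, fun x => le_rfl, fun x => le_rfl, hKV⟩
    | succ n ih =>
      obtain ⟨i1, i2, i3, i4, i5, i6⟩ := ih
      rw [hS]
      have j1 : ∀ x, 0 ≤ (S n).1 x := fun x => (hL0 x).trans (i3 x)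
      have j2 : ∀ x, (S n).1 x ≤ 1 := fun x => (i4 x).trans (hU1 x)
      have j3 : ∀ x, 0 ≤ (S n).2 x := fun x => (hK0 x).trans (i5 x)
      have j4 : ∀ x, (S n).2 x ≤ 1 := fun x => (i6 x).trans (hV1 x)
      refine ⟨hTcont hσ₁ hκ₁ h₁ hγ₁ hγ₁1 i1 i2 j1 j2 j3 j4, hTcont hσ₂ hκ₂ h₂ hγ₂ hγ₂1 i2 i1 j3 j4 j1 j2,
        fun x => ?_, fun x => ?_, fun x => ?_, fun x => ?_⟩
      · exact (lv_sub_le hσ₁ hκ₁ h₁ hγ₁ hγ₁1 hL hVc hL0 hL1 hV0' hV1 hLs x).trans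
          (hmono hσ₁ hκ₁ h₁ hγ₁ hγ₁1 hL hVc i1 i2 hL0 i3 j2 j3 i6 hV1 x)
      · exact (hmono hσ₁ hκ₁ h₁ hγ₁ hγ₁1 i1 i2 hUc hK j1 i4 hU1 hK0 i5 j4 x).trans
          (lv_super_ge hσ₁ hκ₁ h₁ hγ₁ hγ₁1 hU hU' hK hU0 hU1 hK0 hK1 hUs x)
      · exact (lv_sub_le hσ₂ hκ₂ h₂ hγ₂ hγ₂1 hK hUc hK0 hK1 hU0' hU1 hKs x).trans
          (hmono hσ₂ hκ₂ h₂ hγ₂ hγ₂1 hK hUc i2 i1 hK0 i5 j4 j1 i4 hU1 x)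
      · exact (hmono hσ₂ hκ₂ h₂ hγ₂ hγ₂1 i2 i1 hVc hL j3 i6 hV1 hL0 i3 j2 x).trans
          (lv_super_ge hσ₂ hκ₂ h₂ hγ₂ hγ₂1 hV hV' hL hV0 hV1 hL0 hL1 hVs x)
  have j1 : ∀ n x, 0 ≤ (S n).1 x := fun n x => (hL0 x).trans ((hinv n).2.2.1 x)
  have j2 : ∀ n x, (S n).1 x ≤ 1 := fun n x => ((hinv n).2.2.2.1 x).trans (hU1 x)
  have j3 : ∀ n x, 0 ≤ (S n).2 x := fun n x => (hK0 x).trans ((hinv n).2.2.2.2.1 x)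
  have j4 : ∀ n x, (S n).2 x ≤ 1 := fun n x => ((hinv n).2.2.2.2.2 x).trans (hV1 x)
  have hstep : ∀ n, (∀ x, (S (n + 1)).1 x ≤ (S n).1 x) ∧ (∀ x, (S n).2 x ≤ (S (n + 1)).2 x) := by
    intro n
    induction n with
    | zero => exact ⟨fun x => (hinv 1).2.2.2.1 x, fun x => (hinv 1).2.2.2.2.1 x⟩
    | succ n ih =>
      rw [hS (n + 1)]
      constructor
      · intro x
        conv_rhs => rw [hS n]
        exact hmono hσ₁ hκ₁ h₁ hγ₁ hγ₁1 (hinv (n + 1)).1 (hinv (n + 1)).2.1 (hinv n).1 (hinv n).2.1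
          (j1 _) ih.1 (j2 _) (j3 _) ih.2 (j4 _) x
      · intro x
        conv_lhs => rw [hS n]
        exact hmono hσ₂ hκ₂ h₂ hγ₂ hγ₂1 (hinv n).2.1 (hinv n).1 (hinv (n + 1)).2.1 (hinv (n + 1)).1 
          (j3 _) ih.2 (j4 _) (j1 _) ih.1 (j2 _) x
  have hlim1 : ∀ x, ∃ l, Tendsto (fun n => (S n).1 x) atTop (nhds l) := fun x =>
    ⟨_, tendsto_atTop_ciInf (antitone_nat_of_succ_le fun n => (hstep n).1 x)
      ⟨0, by rintro _ ⟨n, rfl⟩; exact j1 n x⟩⟩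
  have hlim2 : ∀ x, ∃ l, Tendsto (fun n => (S n).2 x) atTop (nhds l) := fun x =>
    ⟨_, tendsto_atTop_ciSup (monotone_nat_of_le_succ fun n => (hstep n).2 x)
      ⟨1, by rintro _ ⟨n, rfl⟩; exact j4 n x⟩⟩
  choose u hu using hlim1
  choose v hv using hlim2
  have hcont_of : ∀ (f : ℝ → ℝ) (C : ℝ), (∀ x y, |f x - f y| ≤ C * |x - y|) → Continuous f := by
    intro f C hf
    have hC : 0 ≤ C := by simpa using (abs_nonneg _).trans (hf 1 0)
    refine (LipschitzWith.of_dist_le_mul (K := ⟨C, hC⟩) fun x y => ?_).continuous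
    rw [Real.dist_eq, Real.dist_eq]
    exact hf x y
  have huc : Continuous u := by
    refine hcont_of u ((2 * σ₁ ^ 2 + κ₁) / σ₁) fun x y => ?_
    have ht := (((hu x).comp (tendsto_add_atTop_nat 1)).sub ((hu y).comp (tendsto_add_atTop_nat 1))).abs
    refine le_of_tendsto ht (Eventually.of_forall fun n => ?_)
    simp only [Function.comp, hS]
    exact lv_lip hσ₁ hκ₁ h₁ hγ₁ hγ₁1 (hinv n).1 (hinv n).2.1 (j1 n) (j2 n) (j3 n) (j4 n) x y
  have hvc : Continuous v := by
    refine hcont_of v ((2 * σ₂ ^ 2 + κ₂) / σ₂) fun x y => ?_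
    have ht := (((hv x).comp (tendsto_add_atTop_nat 1)).sub ((hv y).comp (tendsto_add_atTop_nat 1))).abs
    refine le_of_tendsto ht (Eventually.of_forall fun n => ?_)
    simp only [Function.comp, hS]
    exact lv_lip hσ₂ hκ₂ h₂ hγ₂ hγ₂1 (hinv n).2.1 (hinv n).1 (j3 n) (j4 n) (j1 n) (j2 n) x y
  refine ⟨u, v, huc, hvc, fun x => ge_of_tendsto' (hu x) fun n => (hinv n).2.2.1 x,
    fun x => le_of_tendsto' (hu x) fun n => (hinv n).2.2.2.1 x,
    fun x => ge_of_tendsto' (hv x) fun n => (hinv n).2.2.2.2.1 x,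
    fun x => le_of_tendsto' (hv x) fun n => (hinv n).2.2.2.2.2 x, ?_, ?_⟩
  · funext x
    refine tendsto_nhds_unique ((hu x).comp (tendsto_add_atTop_nat 1)) ?_
    simp only [Function.comp_def, hS]
    refine lvT_tendsto hσ₁ (fun n => lvH_cont (hinv n).1 (hinv n).2.1) (M := 2 * σ₁ ^ 2 + κ₁)
      (fun n x => lvH_bound hκ₁ h₁ hγ₁ hγ₁1 x (j1 n x) (j2 n x) (j3 n x) (j4 n x)) (fun y => ?_) x
    unfold lvH
    exact ((hu y).const_mul _).add (((hu y).const_mul _).mul ((((hu y).const_sub 1)).sub ((hv y).const_mul _)))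
  · funext x
    refine tendsto_nhds_unique ((hv x).comp (tendsto_add_atTop_nat 1)) ?_
    simp only [Function.comp_def, hS]
    refine lvT_tendsto hσ₂ (fun n => lvH_cont (hinv n).2.1 (hinv n).1) (M := 2 * σ₂ ^ 2 + κ₂)
      (fun n x => lvH_bound hκ₂ h₂ hγ₂ hγ₂1 x (j3 n x) (j4 n x) (j1 n x) (j2 n x)) (fun y => ?_) x
    unfold lvH
    exact ((hv y).const_mul _).add (((hv y).const_mul _).mul ((((hv y).const_sub 1)).sub ((hu y).const_mul _)))

lemma lv_anti {f f' : ℝ → ℝ} {D : Set ℝ} (hD : Convex ℝ D) (hf : ∀ t, HasDerivAt f (f' t) t)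
    (h : ∀ t ∈ interior D, f' t ≤ 0) : AntitoneOn f D := by
  refine antitoneOn_of_deriv_nonpos hD
    (fun t _ => (hf t).continuousAt.continuousWithinAt)
    (fun t _ => (hf t).differentiableAt.differentiableWithinAt) fun t ht => ?_
  rw [(hf t).deriv]
  exact h t ht

lemma lv_eventually {z z' z'' : ℝ → ℝ} {σ X K B : ℝ} (hσ : 0 < σ) (hz : ∀ t, HasDerivAt z (z' t) t)
    (hz' : ∀ t, HasDerivAt z' (z'' t) t) (hB : ∀ x, |z x| ≤ B)
    (h1 : ∀ x ≥ X, z x < K → z'' x - σ * z' x < 0)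
    (h2 : ∃ η > 0, ∀ x ≥ X, z X ≤ z x → z x < K → z'' x - σ * z' x ≤ -η) :
    ∃ Y, ∀ x ≥ Y, K ≤ z x := by
  have hzc : Continuous z := continuous_iff_continuousAt.2 fun x => (hz x).continuousAt
  have hzc' : Continuous z' := continuous_iff_continuousAt.2 fun x => (hz' x).continuousAt
  let g : ℝ → ℝ := fun t => exp (-σ * t) * z' t
  have hg : ∀ t, HasDerivAt g (exp (-σ * t) * (z'' t - σ * z' t)) t := by
    intro t
    have he := ((hasDerivAt_id t).const_mul (-σ)).exp
    refine (he.mul (hz' t)).congr_deriv ?_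
    simp only [id]
    ring
  have c1 : ∀ x0 ≥ X, z x0 < K → 0 ≤ z' x0 := by
    intro x0 hx0 hzx0
    by_contra hneg0
    push Not at hneg0
    have hneg : ∀ t ≥ x0, z' t < 0 := by
      by_contra hcon
      push Not at hcon
      obtain ⟨t2, ht2, ht2'⟩ := hcon
      have hcomp : IsCompact (Set.Icc x0 t2 ∩ {t | 0 ≤ z' t}) :=
        isCompact_Icc.inter_right (isClosed_le continuous_const hzc')
      obtain ⟨x1, ⟨⟨hx1, hx1t⟩, hx1'⟩, hleast⟩ :=
        hcomp.exists_isLeast ⟨t2, ⟨ht2, le_rfl⟩, ht2'⟩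
      have hlt : ∀ t ∈ Set.Ico x0 x1, z' t < 0 := by
        intro t ht
        by_contra hc
        push Not at hc
        have := hleast ⟨⟨ht.1, ht.2.le.trans hx1t⟩, hc⟩
        linarith [ht.2]
      have a1 : AntitoneOn z (Set.Icc x0 x1) := by
        refine lv_anti (convex_Icc _ _) hz fun t ht => ?_
        rw [interior_Icc] at ht
        exact (hlt t ⟨ht.1.le, ht.2⟩).le
      have a2 : AntitoneOn g (Set.Icc x0 x1) := by
        refine lv_anti (convex_Icc _ _) hg fun t ht => ?_
        rw [interior_Icc] at ht
        have h3 : z t ≤ z x0 := a1 ⟨le_rfl, hx1⟩ ⟨ht.1.le, ht.2.le⟩ ht.1.le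
        have h4 := h1 t (hx0.trans ht.1.le) (by linarith)
        exact mul_nonpos_of_nonneg_of_nonpos (exp_pos _).le h4.le
      have h5 : g x1 ≤ g x0 := a2 ⟨le_rfl, hx1⟩ ⟨hx1, le_rfl⟩ hx1
      have h6 : g x0 < 0 := mul_neg_of_pos_of_neg (exp_pos _) hneg0
      have h7 : 0 ≤ g x1 := mul_nonneg (exp_pos _).le hx1'
      linarith
    have a1 : AntitoneOn z (Set.Ici x0) := by
      refine lv_anti (convex_Ici _) hz fun t ht => ?_
      rw [interior_Ici] at ht
      exact (hneg t ht.le).le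
    have hzK : ∀ t ≥ x0, z t < K := fun t ht => (a1 (Set.mem_Ici.2 le_rfl) ht ht).trans_lt hzx0
    have a2 : AntitoneOn g (Set.Ici x0) := by
      refine lv_anti (convex_Ici _) hg fun t ht => ?_
      rw [interior_Ici] at ht
      exact mul_nonpos_of_nonneg_of_nonpos (exp_pos _).le (h1 t (hx0.trans ht.le) (hzK t ht.le)).le
    have h3 : ∀ t ≥ x0, z' t ≤ z' x0 := by
      intro t ht
      have h4 : g t ≤ g x0 := a2 (Set.mem_Ici.2 le_rfl) ht ht
      have h5 : exp (-σ * t) ≤ exp (-σ * x0) := exp_le_exp.2 (by nlinarith)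
      have h6 : exp (-σ * x0) * z' x0 ≤ exp (-σ * t) * z' x0 := by nlinarith
      have h7 : exp (-σ * t) * z' t ≤ exp (-σ * t) * z' x0 := h4.trans h6
      exact le_of_mul_le_mul_left h7 (exp_pos _)
    have a3 : AntitoneOn (fun t => z t - z' x0 * t) (Set.Ici x0) := by
      refine lv_anti (convex_Ici _) (fun t => (hz t).sub ((hasDerivAt_id t).const_mul (z' x0))) fun t ht => ?_
      rw [interior_Ici] at ht
      have := h3 t ht.le
      linarith
    have hB0 : 0 ≤ B := (abs_nonneg _).trans (hB 0)
    set T := x0 + (2 * B + 1) / (- z' x0) with hT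
    have hTx : x0 ≤ T := by
      have : 0 ≤ (2 * B + 1) / (- z' x0) := div_nonneg (by linarith) (by linarith)
      linarith
    have h4 := a3 (Set.mem_Ici.2 le_rfl) hTx hTx
    have h5 : z' x0 * (T - x0) = - (2 * B + 1) := by
      rw [hT, add_sub_cancel_left, div_neg, mul_neg, mul_div_cancel₀ _ hneg0.ne]
    dsimp only at h4
    have h6 := (abs_le.1 (hB x0)).2
    have h7 := (abs_le.1 (hB T)).1
    linarith
  have c2 : ∃ x ≥ X, K ≤ z x := by
    by_contra hcon
    push Not at hcon
    obtain ⟨η, hη, h2⟩ := h2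
    have a1 : AntitoneOn (fun t => -z t) (Set.Ici X) := by
      refine lv_anti (convex_Ici _) (fun t => (hz t).neg) fun t ht => ?_
      rw [interior_Ici] at ht
      have := c1 t ht.le (hcon t ht.le)
      linarith
    have hge : ∀ t ≥ X, z X ≤ z t := fun t ht => by
      have := a1 (Set.mem_Ici.2 le_rfl) ht ht
      dsimp only at this; linarith
    have a2 : AntitoneOn (fun t => z' t - σ * z t + η * t) (Set.Ici X) := by
      refine lv_anti (convex_Ici _) (fun t => ((hz' t).sub ((hz t).const_mul σ)).add
        ((hasDerivAt_id t).const_mul η)) fun t ht => ?_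
      rw [interior_Ici] at ht
      have := h2 t ht.le (hge t ht.le) (hcon t ht.le)
      linarith
    have hB0 : 0 ≤ B := (abs_nonneg _).trans (hB 0)
    have hXp := c1 X le_rfl (hcon X le_rfl)
    set T := X + (z' X + 2 * σ * B + 1) / η with hT
    have hTx : X ≤ T := by
      have : 0 ≤ (z' X + 2 * σ * B + 1) / η := by positivity
      linarith
    have h4 := a2 (Set.mem_Ici.2 le_rfl) hTx hTx
    have h5 : η * (T - X) = z' X + 2 * σ * B + 1 := by
      rw [hT, add_sub_cancel_left, mul_div_cancel₀ _ hη.ne']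
    have hTp := c1 T hTx (hcon T hTx)
    dsimp only at h4
    have h6 := mul_le_mul_of_nonneg_left (abs_le.1 (hB X)).1 hσ.le
    have h7 := mul_le_mul_of_nonneg_left (abs_le.1 (hB T)).2 hσ.le
    linarith
  obtain ⟨Y, hY, hYK⟩ := c2
  refine ⟨Y, fun x hx => ?_⟩
  by_contra hlt
  push Not at hlt
  have hcomp : IsCompact (Set.Icc Y x ∩ {t | K ≤ z t}) :=
    isCompact_Icc.inter_right (isClosed_le continuous_const hzc)
  obtain ⟨x1, ⟨⟨hx1, hx1t⟩, hx1'⟩, hgr⟩ :=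
    hcomp.exists_isGreatest ⟨Y, ⟨le_rfl, hx⟩, hYK⟩
  have a1 : AntitoneOn (fun t => -z t) (Set.Icc x1 x) := by
    refine lv_anti (convex_Icc _ _) (fun t => (hz t).neg) fun t ht => ?_
    rw [interior_Icc] at ht
    have h3 : z t < K := by
      by_contra hc
      push Not at hc
      have := hgr ⟨⟨hx1.trans ht.1.le, ht.2.le⟩, hc⟩
      linarith [ht.1]
    have := c1 t (hY.le.trans (hx1.trans ht.1.le)) h3
    linarith
  have h3 := a1 ⟨le_rfl, hx1t⟩ ⟨hx1t, le_rfl⟩ hx1t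
  dsimp only at h3
  have h4 : K ≤ z x1 := hx1'
  linarith

lemma lv_contract {u u' u'' v : ℝ → ℝ} {σ κ γ us vs r q : ℝ} (hσ : 0 < σ) (hκ : 0 < κ)
    (hγ : 0 ≤ γ) (hq : γ < q) (hr : 0 < r) (hus : 0 < us) (huv : us = 1 - γ * vs)
    (hu : ∀ t, HasDerivAt u (u' t) t) (hu' : ∀ t, HasDerivAt u' (u'' t) t)
    (hu0 : ∀ x, 0 < u x) (hu1 : ∀ x, u x ≤ 1)
    (hode : ∀ x, u'' x - σ * u' x + κ * u x * (1 - u x - γ * v x) = 0)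
    (hv : ∀ᶠ x in atTop, |v x - vs| ≤ r) : ∀ᶠ x in atTop, |u x - us| ≤ q * r := by
  obtain ⟨X, hX⟩ := eventually_atTop.1 hv
  set ε := (q - γ) * r with hε
  have hε0 : 0 < ε := mul_pos (by linarith) hr
  have hlow : ∃ Y, ∀ x ≥ Y, us - q * r ≤ u x := by
    refine lv_eventually (B := 1) (X := X) hσ hu hu' (fun x => abs_le.2 ⟨by linarith [hu0 x], hu1 x⟩) ?_ ?_
    · intro x hx hlt
      have h1 := mul_le_mul_of_nonneg_left (abs_le.1 (hX x hx)).2 hγ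
      have h2 : ε ≤ 1 - u x - γ * v x := by linarith
      have h3 := mul_pos (mul_pos hκ (hu0 x)) (hε0.trans_le h2)
      linarith [hode x]
    · refine ⟨κ * u X * ε, mul_pos (mul_pos hκ (hu0 X)) hε0, fun x hx hXx hlt => ?_⟩
      have h1 := mul_le_mul_of_nonneg_left (abs_le.1 (hX x hx)).2 hγ
      have h2 : ε ≤ 1 - u x - γ * v x := by linarith
      have h3 : κ * u X * ε ≤ κ * u x * (1 - u x - γ * v x) := by
        have := hu0 x
        gcongr
      linarith [hode x]
  have hup : ∃ Y, ∀ x ≥ Y, -(us + q * r) ≤ -u x := by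
    have hpos : 0 < us + q * r := by
      have : 0 < q * r := mul_pos (by linarith) hr
      linarith
    have key : ∀ x ≥ X, -u x < -(us + q * r) → -u'' x - σ * (-u' x) ≤ -(κ * (us + q * r) * ε) := by
      intro x hx hlt
      have h1 := mul_le_mul_of_nonneg_left (abs_le.1 (hX x hx)).1 hγ
      have h2 : ε ≤ -(1 - u x - γ * v x) := by linarith
      have h3 : κ * (us + q * r) * ε ≤ κ * u x * -(1 - u x - γ * v x) := by
        have := hu0 x
        have : us + q * r ≤ u x := by linarith
        gcongr
      linarith [hode x]
    have hp := mul_pos (mul_pos hκ hpos) hε0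
    refine lv_eventually (z := fun x => -u x) (z' := fun x => -u' x) (z'' := fun x => -u'' x)
      (B := 1) (X := X) hσ (fun t => (hu t).neg) (fun t => (hu' t).neg)
      (fun x => abs_le.2 ⟨by linarith [hu1 x], by linarith [hu0 x]⟩) ?_ ?_
    · intro x hx hlt
      linarith [key x hx hlt]
    · exact ⟨_, hp, fun x hx _ hlt => key x hx hlt⟩
  obtain ⟨Y1, hY1⟩ := hlow
  obtain ⟨Y2, hY2⟩ := hup
  filter_upwards [eventually_ge_atTop Y1, eventually_ge_atTop Y2] with x a1 a2
  have := hY1 x a1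
  have := hY2 x a2
  exact abs_le.2 ⟨by linarith, by linarith⟩

lemma lv_pos {u w H : ℝ → ℝ} {σ : ℝ} (hu : ∀ t, HasDerivAt u (w t - σ * u t) t) (hw : ∀ t, 0 ≤ w t)
    (hX : ∃ X, ∀ x ≤ X, 0 < u x) (x : ℝ) : 0 < u x := by
  obtain ⟨X, hX⟩ := hX
  have hg : ∀ t, HasDerivAt (fun t => -(exp (σ * t) * u t)) (-(exp (σ * t) * w t)) t := by
    intro t
    have he := ((hasDerivAt_id t).const_mul σ).exp
    refine (he.mul (hu t)).neg.congr_deriv ?_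
    simp only [id]
    ring
  have a1 : AntitoneOn (fun t => -(exp (σ * t) * u t)) Set.univ := by
    refine lv_anti convex_univ hg fun t _ => ?_
    have := mul_nonneg (exp_pos (σ * t)).le (hw t)
    linarith
  have h1 := a1 (Set.mem_univ (min x X)) (Set.mem_univ x) (min_le_left _ _)
  dsimp only at h1
  have h2 := mul_pos (exp_pos (σ * min x X)) (hX _ (min_le_right x X))
  have h3 : 0 < exp (σ * x) * u x := by linarith
  exact (pos_iff_pos_of_mul_pos h3).1 (exp_pos _)

lemma lv_regular {σ κ γ : ℝ} (hσ : 0 < σ) (hκ : 0 < κ) (h : 4 * κ ≤ σ ^ 2) (hγ : 0 ≤ γ) (hγ1 : γ ≤ 1)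
    {u v : ℝ → ℝ} (hu : Continuous u) (hv : Continuous v) (hu0 : ∀ x, 0 ≤ u x) (hu1 : ∀ x, u x ≤ 1)
    (hv0 : ∀ x, 0 ≤ v x) (hv1 : ∀ x, v x ≤ 1) (hfix : u = lvT σ (lvH σ κ γ u v))
    (hX : ∃ X, ∀ x ≤ X, 0 < u x) :
    ∃ u' u'' : ℝ → ℝ, (∀ t, HasDerivAt u (u' t) t) ∧ (∀ t, HasDerivAt u' (u'' t) t) ∧ Continuous u'' ∧
      (∀ x, u'' x - σ * u' x + κ * u x * (1 - u x - γ * v x) = 0) ∧ (∀ x, 0 < u x) := by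
  have hc := lvH_cont (σ := σ) (κ := κ) (γ := γ) hu hv
  have hM : ∀ x, |lvH σ κ γ u v x| ≤ 2 * σ ^ 2 + κ := fun x =>
    lvH_bound hκ h hγ hγ1 x (hu0 x) (hu1 x) (hv0 x) (hv1 x)
  obtain ⟨d1, d2, -⟩ := lvT_spec hσ hc hM
  rw [← hfix] at d1 d2
  have hA : ∀ x, 0 ≤ lvA (2 * σ) (lvH σ κ γ u v) x := by
    intro x
    have h1 := lvA_mono (p := 2 * σ) (by linarith) (H := fun _ => 0) (M := 0) continuous_const (by simp) hc hM
      (fun x => lvH_nonneg hκ h hγ hγ1 x (hu0 x) (hu1 x) (hv0 x) (hv1 x)) x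
    have h2 : lvA (2 * σ) (fun _ => 0) x = 0 := by simp [lvA]
    linarith
  have hAc := lvA_cont (p := 2 * σ) (by linarith) hc hM
  refine ⟨_, _, d1, d2, by fun_prop, fun x => ?_, lv_pos (H := u) d1 hA hX⟩
  unfold lvH
  ring

theorem lv_wave (σ₁ κ₁ σ₂ κ₂ : ℝ) (hσ₁ : 0 < σ₁) (hκ₁ : 0 < κ₁) (h₁ : 4 * κ₁ ≤ σ₁ ^ 2)
    (hσ₂ : 0 < σ₂) (hκ₂ : 0 < κ₂) (h₂ : 4 * κ₂ ≤ σ₂ ^ 2) :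
    ∃ m > 0, ∀ γ₁ γ₂ : ℝ, 0 < γ₁ → γ₁ < 1 → 0 < γ₂ → γ₂ < 1 →
      ∃ u u' u'' v v' v'' : ℝ → ℝ,
        (∀ t, HasDerivAt u (u' t) t) ∧ (∀ t, HasDerivAt u' (u'' t) t) ∧ Continuous u'' ∧
        (∀ t, HasDerivAt v (v' t) t) ∧ (∀ t, HasDerivAt v' (v'' t) t) ∧ Continuous v'' ∧
        (∀ x, 0 < u x) ∧ (∀ x, 0 < v x) ∧
        (∀ x, u'' x - σ₁ * u' x + κ₁ * u x * (1 - u x - γ₁ * v x) = 0) ∧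
        (∀ x, v'' x - σ₂ * v' x + κ₂ * v x * (1 - v x - γ₂ * u x) = 0) ∧
        Tendsto u atBot (nhds 0) ∧ Tendsto v atBot (nhds 0) ∧
        Tendsto u atTop (nhds ((1 - γ₁) / (1 - γ₁ * γ₂))) ∧
        Tendsto v atTop (nhds ((1 - γ₂) / (1 - γ₁ * γ₂))) ∧ ∃ x, m ≤ u x := by
  obtain ⟨U, U', U'', hU, hU', hU0, hU1, hUs, hUe, hUsub⟩ := lv_scalar σ₁ κ₁ hσ₁ hκ₁ h₁
  obtain ⟨V, V', V'', hV, hV', hV0, hV1, hVs, hVe, hVsub⟩ := lv_scalar σ₂ κ₂ hσ₂ hκ₂ h₂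
  obtain ⟨L, hL, hL0, hLU, ⟨XL, hXL⟩, hLs⟩ := hUsub V hVe
  obtain ⟨K, hK, hK0, hKV, ⟨XK, hXK⟩, hKs⟩ := hVsub U hUe
  refine ⟨L XL, hXL XL le_rfl, fun γ₁ γ₂ hγ₁ hγ₁1 hγ₂ hγ₂1 => ?_⟩
  obtain ⟨u, v, huc, hvc, hLu, huU, hKv, hvV, hfu, hfv⟩ := lv_fixed (γ₁ := γ₁) (γ₂ := γ₂)
    hσ₁ hκ₁ h₁ hγ₁.le hγ₁1.le hσ₂ hκ₂ h₂ hγ₂.le hγ₂1.le hU hU' hU0 hU1 hUs hV hV' hV0 hV1 hVs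
    hL hL0 hLU hLs hK hK0 hKV hKs
  have hu1 : ∀ x, u x ≤ 1 := fun x => (huU x).trans (hU1 x)
  have hv1 : ∀ x, v x ≤ 1 := fun x => (hvV x).trans (hV1 x)
  have hu0 : ∀ x, 0 ≤ u x := fun x => (hL0 x).trans (hLu x)
  have hv0 : ∀ x, 0 ≤ v x := fun x => (hK0 x).trans (hKv x)
  obtain ⟨u', u'', du, du', cu, ou, pu⟩ := lv_regular hσ₁ hκ₁ h₁ hγ₁.le hγ₁1.le huc hvc hu0 hu1 hv0 hv1 hfu
    ⟨XL, fun x hx => (hXL x hx).trans_le (hLu x)⟩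
  obtain ⟨v', v'', dv, dv', cv, ov, pv⟩ := lv_regular hσ₂ hκ₂ h₂ hγ₂.le hγ₂1.le hvc huc hv0 hv1 hu0 hu1 hfv
    ⟨XK, fun x hx => (hXK x hx).trans_le (hKv x)⟩
  have hbot : ∀ W : ℝ → ℝ, (∃ ρ > 0, ∀ x, W x ≤ 2 * exp (ρ * x)) → ∀ w : ℝ → ℝ, (∀ x, 0 ≤ w x) →
      (∀ x, w x ≤ W x) → Tendsto w atBot (nhds 0) := by
    rintro W ⟨ρ, hρ, hW⟩ w hw hwW
    have h1 : Tendsto (fun x => 2 * exp (ρ * x)) atBot (nhds (2 * 0)) :=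
      (Real.tendsto_exp_atBot.comp (tendsto_id.const_mul_atBot hρ)).const_mul 2
    rw [mul_zero] at h1
    exact squeeze_zero hw (fun x => (hwW x).trans (hW x)) h1
  have hg : γ₁ * γ₂ < 1 := by nlinarith
  set us := (1 - γ₁) / (1 - γ₁ * γ₂) with hus
  set vs := (1 - γ₂) / (1 - γ₁ * γ₂) with hvs
  have hne : 1 - γ₁ * γ₂ ≠ 0 := by linarith
  have us0 : 0 < us := div_pos (by linarith) (by linarith)
  have vs0 : 0 < vs := div_pos (by linarith) (by linarith)
  have us1 : us ≤ 1 := by rw [hus, div_le_one (by linarith)]; nlinarith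
  have vs1 : vs ≤ 1 := by rw [hvs, div_le_one (by linarith)]; nlinarith
  have e1 : us = 1 - γ₁ * vs := by rw [hus, hvs]; field_simp; ring
  have e2 : vs = 1 - γ₂ * us := by
    rw [hus, hvs, eq_sub_iff_add_eq, mul_div_assoc', ← add_div, div_eq_one_iff_eq hne]; ring
  obtain ⟨q, hq1, hq⟩ := exists_between (max_lt hγ₁1 hγ₂1)
  have hq₁ : γ₁ < q := (le_max_left _ _).trans_lt hq1
  have hq₂ : γ₂ < q := (le_max_right _ _).trans_lt hq1
  have hq0 : 0 < q := hγ₁.trans hq₁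
  have hP : ∀ n : ℕ, (∀ᶠ x in atTop, |u x - us| ≤ q ^ n) ∧ (∀ᶠ x in atTop, |v x - vs| ≤ q ^ n) := by
    intro n
    induction n with
    | zero =>
      refine ⟨Eventually.of_forall fun x => ?_, Eventually.of_forall fun x => ?_⟩
      · rw [pow_zero]; exact abs_le.2 ⟨by linarith [hu0 x], by linarith [hu1 x]⟩
      · rw [pow_zero]; exact abs_le.2 ⟨by linarith [hv0 x], by linarith [hv1 x]⟩
    | succ n ih =>
      rw [pow_succ']
      exact ⟨lv_contract hσ₁ hκ₁ hγ₁.le hq₁ (pow_pos hq0 n) us0 e1 du du' pu hu1 ou ih.2,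
        lv_contract hσ₂ hκ₂ hγ₂.le hq₂ (pow_pos hq0 n) vs0 e2 dv dv' pv hv1 ov ih.1⟩
  have htop : ∀ (w : ℝ → ℝ) (l : ℝ), (∀ n : ℕ, ∀ᶠ x in atTop, |w x - l| ≤ q ^ n) →
      Tendsto w atTop (nhds l) := by
    intro w l hw
    rw [Metric.tendsto_nhds]
    intro ε hε
    obtain ⟨n, hn⟩ := exists_pow_lt_of_lt_one hε hq
    filter_upwards [hw n] with x hx
    rw [Real.dist_eq]
    exact hx.trans_lt hn
  exact ⟨u, u', u'', v, v', v'', du, du', cu, dv, dv', cv, pu, pv, ou, ov, hbot U hUe u hu0 huU,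
    hbot V hVe v hv0 hvV, htop u us fun n => (hP n).1, htop v vs fun n => (hP n).2, XL, hLu XL⟩

lemma lv_contDiff {u u' u'' : ℝ → ℝ} (du : ∀ t, HasDerivAt u (u' t) t)
    (du' : ∀ t, HasDerivAt u' (u'' t) t) (hc : Continuous u'') : ContDiff ℝ 2 u := by
  have e : deriv u = u' := funext fun t => (du t).deriv
  have e' : deriv u' = u'' := funext fun t => (du' t).deriv
  have h1 : ContDiff ℝ 1 u' := by
    rw [contDiff_one_iff_deriv]
    exact ⟨fun t => (du' t).differentiableAt, by rw [e']; exact hc⟩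
  have : ContDiff ℝ (1 + 1) u := by
    rw [contDiff_succ_iff_deriv]
    exact ⟨fun t => (du t).differentiableAt, by simp, by rw [e]; exact h1⟩
  simpa [one_add_one_eq_two] using this

/-- Sufficient condition for non-monotone waves in the `u`-component. -/
theorem u_nonmonotone_wave
    (a b d : ℝ) (hd : 0 < d) (hb : 0 < b) (hba : b < a)
    (s : ℝ) (hs : max 2 (2 * Real.sqrt (a * d)) ≤ s) :
    ∃ δ : ℝ, 0 < δ ∧ δ < 1 / a ∧
      ∀ c : ℝ, δ < c → c < 1 / a →
        ∃ u v : ℝ → ℝ, ContDiff ℝ 2 u ∧ ContDiff ℝ 2 v ∧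
          (∀ ξ : ℝ, 0 < u ξ) ∧ (∀ ξ : ℝ, 0 < v ξ) ∧
          (∀ ξ : ℝ, deriv (deriv u) ξ - s * deriv u ξ + u ξ * (1 - u ξ - c * v ξ) = 0) ∧
          (∀ ξ : ℝ, d * deriv (deriv v) ξ - s * deriv v ξ + v ξ * (a - b * u ξ - v ξ) = 0) ∧
          Tendsto u atBot (nhds 0) ∧ Tendsto v atBot (nhds 0) ∧
          Tendsto u atTop (nhds ((1 - a * c) / (1 - b * c))) ∧
          Tendsto v atTop (nhds ((a - b) / (1 - b * c))) ∧
          ¬ Monotone u ∧ ¬ Antitone u := by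
  have ha : 0 < a := hb.trans hba
  have hs2 : 2 ≤ s := (le_max_left _ _).trans hs
  have hs3 : 2 * √(a * d) ≤ s := (le_max_right _ _).trans hs
  have hs4 : 4 * (a * d) ≤ s ^ 2 := by
    have h1 := Real.sq_sqrt (mul_pos ha hd).le
    have h2 := Real.sqrt_nonneg (a * d)
    nlinarith
  obtain ⟨m, hm, hw⟩ := lv_wave s 1 (s / d) (a / d) (by linarith) one_pos (by nlinarith)
    (by positivity) (by positivity) (by
      rw [div_pow, ← mul_div_assoc, div_le_div_iff₀ hd (by positivity)]
      nlinarith)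
  have hba1 : b / a < 1 := (div_lt_one ha).2 hba
  have hba0 : 0 < b / a := by positivity
  refine ⟨max (1 / 2) (1 - m * (1 - b / a)) / a, by positivity, ?_, ?_⟩
  · refine div_lt_div_of_pos_right (max_lt (by norm_num) ?_) ha
    have : 0 < m * (1 - b / a) := mul_pos hm (by linarith)
    linarith
  intro c hc1 hc2
  rw [div_lt_iff₀ ha] at hc1
  rw [lt_div_iff₀ ha] at hc2
  have hc3 : 1 / 2 < c * a := (le_max_left _ _).trans_lt hc1
  have hc4 : 1 - m * (1 - b / a) < c * a := (le_max_right _ _).trans_lt hc1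
  obtain ⟨u, u', u'', v, v', v'', du, du', cu, dv, dv', cv, pu, pv, ou, ov, tu, tv, lu, lv, x, hx⟩ :=
    hw (c * a) (b / a) (by linarith) hc2 hba0 hba1
  have eg : 1 - c * a * (b / a) = 1 - b * c := by field_simp
  have hlt : (1 - a * c) / (1 - b * c) < m := by
    rw [← eg, div_lt_iff₀ (by nlinarith)]
    have h3 : 1 - b / a ≤ 1 - c * a * (b / a) := by nlinarith
    have h4 : m * (1 - b / a) ≤ m * (1 - c * a * (b / a)) := by gcongr
    linarith
  have e1 : deriv u = u' := funext fun t => (du t).deriv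
  have e2 : deriv u' = u'' := funext fun t => (du' t).deriv
  have e3 : deriv (fun t => a * v t) = fun t => a * v' t := funext fun t => ((dv t).const_mul a).deriv
  have e4 : deriv (fun t => a * v' t) = fun t => a * v'' t := funext fun t => ((dv' t).const_mul a).deriv
  rw [eg] at lu lv
  rw [mul_comm c a] at lu
  refine ⟨u, fun t => a * v t, lv_contDiff du du' cu,
    lv_contDiff (fun t => (dv t).const_mul a) (fun t => (dv' t).const_mul a) (by fun_prop), pu,
    fun t => mul_pos ha (pv t), fun t => ?_, fun t => ?_, tu, ?_, lu, ?_, fun hmon => ?_, fun hant => ?_⟩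
  · rw [e1, e2]
    linear_combination ou t
  · rw [e3, e4]
    have h5 := ov t
    field_simp at h5
    linear_combination a * h5
  · simpa using tv.const_mul a
  · have := lv.const_mul a
    convert this using 2
    field_simp
  · have := hmon.ge_of_tendsto lu x
    linarith
  · have := hant.ge_of_tendsto tu x
    linarith [pu x]
end
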